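/- arXiv:1303.2960 — 6 statements merged into one kernel-verified Lean document; each statement's English description precedes it below -/
import Mathlib

section
/- Let F ⊂ ℝ² be a bounded measurable set of positive area, let h > 0, and let Q = F × (0,h) ⊂ ℝ³. For every p ∈ [1,∞) there exists a constant C depending only on p such that for every function v : ℝ³ → ℝ that is continuously differentiable on a neighborhood of the closure of Q one has ∫_F |v(x₁,x₂,0)|^p dx₁dx₂ ≤ C h⁻¹ ( ∫_Q |v(x)|^p dx + h^p ∫_Q |∂₃v(x)|^p dx ), where ∂₃ denotes the partial derivative with respect to the third coordinate. -/
open MeasureTheory Set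

/-- Jensen's inequality for the `p`-th power of an integral over an interval. -/
lemma rpow_setIntegral_Ioo_le {p h : ℝ} (hp : 1 ≤ p) (hh : 0 < h) {f : ℝ → ℝ}
    (hf : ContinuousOn f (Icc 0 h)) (hf0 : ∀ t, 0 ≤ f t) :
    (∫ t in Ioo 0 h, f t) ^ p ≤ h ^ p * (h⁻¹ * ∫ t in Ioo 0 h, f t ^ p) := by
  have hp0 : 0 ≤ p := zero_le_one.trans hp
  have hi : IntegrableOn f (Ioo 0 h) :=
    (hf.integrableOn_compact isCompact_Icc).mono_set Ioo_subset_Icc_self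
  have hip : IntegrableOn (fun t => f t ^ p) (Ioo 0 h) :=
    ((hf.rpow_const fun _ _ => Or.inr hp0).integrableOn_compact isCompact_Icc).mono_set
      Ioo_subset_Icc_self
  have key := (convexOn_rpow hp).map_set_average_le (μ := volume) (t := Ioo 0 h) (f := f)
    (Real.continuous_rpow_const hp0).continuousOn isClosed_Ici (by simp [hh]) (by simp)
    (Filter.Eventually.of_forall hf0) hi hip
  have hvol : volume.real (Ioo 0 h) = h := by simp [Measure.real, hh.le]
  simp only [setAverage_eq, hvol, smul_eq_mul] at key
  have hI : 0 ≤ ∫ t in Ioo 0 h, f t := integral_nonneg hf0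
  calc (∫ t in Ioo 0 h, f t) ^ p = h ^ p * (h⁻¹ * ∫ t in Ioo 0 h, f t) ^ p := by
        rw [← Real.mul_rpow hh.le (by positivity), mul_inv_cancel_left₀ hh.ne']
    _ ≤ _ := by gcongr

lemma rpow_add_le_mul_rpow_add_rpow {p a b : ℝ} (ha : 0 ≤ a) (hb : 0 ≤ b) (hp : 1 ≤ p) :
    (a + b) ^ p ≤ 2 ^ (p - 1) * (a ^ p + b ^ p) := by
  lift a to NNReal using ha
  lift b to NNReal using hb
  exact_mod_cast NNReal.rpow_add_le_mul_rpow_add_rpow a b hp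

/-- The one-dimensional trace inequality at the left endpoint of `(0,h)`. -/
lemma rpow_abs_apply_zero_le {p h : ℝ} (hp : 1 ≤ p) (hh : 0 < h) {g g' : ℝ → ℝ}
    (hg : ∀ t ∈ Icc 0 h, HasDerivAt g (g' t) t) (hg' : ContinuousOn g' (Icc 0 h)) :
    |g 0| ^ p ≤ 2 ^ (p - 1) * h⁻¹ *
      ((∫ t in Ioo 0 h, |g t| ^ p) + h ^ p * ∫ t in Ioo 0 h, |g' t| ^ p) := by
  have hp0 : 0 ≤ p := zero_le_one.trans hp
  have hgc : ContinuousOn g (Icc 0 h) := fun t ht => (hg t ht).continuousAt.continuousWithinAt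
  have hi : IntegrableOn (fun t => |g t| ^ p) (Ioo 0 h) :=
    ((hgc.abs.rpow_const fun _ _ => Or.inr hp0).integrableOn_compact isCompact_Icc).mono_set
      Ioo_subset_Icc_self
  have hi' : IntegrableOn (fun t => |g' t|) (Ioo 0 h) :=
    (hg'.abs.integrableOn_compact isCompact_Icc).mono_set Ioo_subset_Icc_self
  have hvol : volume.real (Ioo 0 h) = h := by simp [Measure.real, hh.le]
  set J := ∫ t in Ioo 0 h, |g' t|
  have hJ0 : 0 ≤ J := integral_nonneg fun _ => abs_nonneg _
  have hpt : ∀ t ∈ Ioo 0 h, |g 0| ^ p ≤ 2 ^ (p - 1) * (|g t| ^ p + J ^ p) := by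
    intro t ht
    have hsub : uIcc 0 t ⊆ Icc 0 h := by
      rw [uIcc_of_le ht.1.le]; exact Icc_subset_Icc_right ht.2.le
    have hftc : ∫ s in 0..t, g' s = g t - g 0 :=
      intervalIntegral.integral_eq_sub_of_hasDerivAt (fun s hs => hg s (hsub hs))
        (hg'.mono hsub).intervalIntegrable
    have hle : |g t - g 0| ≤ J := by
      rw [← hftc]
      refine (intervalIntegral.abs_integral_le_integral_abs ht.1.le).trans ?_
      rw [intervalIntegral.integral_of_le ht.1.le]
      exact setIntegral_mono_set hi' (Filter.Eventually.of_forall fun _ => abs_nonneg _)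
        (Ioc_subset_Ioo_right ht.2).eventuallyLE
    have habs : |g 0| ≤ |g t| + J := by
      have := abs_sub_abs_le_abs_sub (g 0) (g t)
      rw [abs_sub_comm] at this
      linarith
    exact (Real.rpow_le_rpow (abs_nonneg _) habs hp0).trans
      (rpow_add_le_mul_rpow_add_rpow (abs_nonneg _) hJ0 hp)
  have hint : h * |g 0| ^ p ≤ 2 ^ (p - 1) * ((∫ t in Ioo 0 h, |g t| ^ p) + h * J ^ p) := by
    have hconst : IntegrableOn (fun _ : ℝ => J ^ p) (Ioo 0 h) := integrableOn_const (by simp)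
    have := setIntegral_mono_on (integrableOn_const (by simp))
      ((hi.add hconst).const_mul (2 ^ (p - 1))) measurableSet_Ioo hpt
    simp only [Pi.add_apply] at this
    rwa [integral_const_mul, integral_add hi hconst, setIntegral_const, setIntegral_const, hvol,
      smul_eq_mul, smul_eq_mul] at this
  have hjensen := rpow_setIntegral_Ioo_le hp hh hg'.abs fun _ => abs_nonneg _
  calc |g 0| ^ p = h⁻¹ * (h * |g 0| ^ p) := (inv_mul_cancel_left₀ hh.ne' _).symm
    _ ≤ h⁻¹ * (2 ^ (p - 1) * ((∫ t in Ioo 0 h, |g t| ^ p) +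
          h * (h ^ p * (h⁻¹ * ∫ t in Ioo 0 h, |g' t| ^ p)))) := by
        refine mul_le_mul_of_nonneg_left (hint.trans ?_) (by positivity)
        gcongr
    _ = _ := by field_simp

/-- Trace inequality on a right prism `Q = F × (0,h)` over its bottom
face `F ⊂ ℝ²`: for every `p ∈ [1,∞)` there is a constant `C = C(p)` such that
`∫_F |v(·,·,0)|^p ≤ C h⁻¹ (∫_Q |v|^p + h^p ∫_Q |∂₃ v|^p)`
for all `v` continuously differentiable on a neighborhood of the closure of `Q`. -/
theorem trace_on_bottom_face_of_right_prism :
    ∀ p : ℝ, 1 ≤ p →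
    ∃ C : ℝ, 0 < C ∧
      ∀ F : Set (ℝ × ℝ), MeasurableSet F → Bornology.IsBounded F → 0 < volume F →
      ∀ h : ℝ, 0 < h →
      ∀ v : (ℝ × ℝ) × ℝ → ℝ,
        (∃ U : Set ((ℝ × ℝ) × ℝ), IsOpen U ∧ closure (F ×ˢ Ioo 0 h) ⊆ U ∧
          ContDiffOn ℝ 1 v U) →
        (∫ y in F, |v (y, 0)| ^ p) ≤
          C * h⁻¹ * ((∫ x in F ×ˢ Ioo 0 h, |v x| ^ p) +
            h ^ p * ∫ x in F ×ˢ Ioo 0 h, |fderiv ℝ v x ((0, 0), 1)| ^ p) := by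
  intro p hp
  have hp0 : 0 ≤ p := zero_le_one.trans hp
  refine ⟨2 ^ (p - 1), by positivity, ?_⟩
  rintro F hF hFb - h hh v ⟨U, hU, hQU, hv⟩
  have hcl : closure (F ×ˢ Ioo 0 h) = closure F ×ˢ Icc 0 h := by
    rw [closure_prod_eq, closure_Ioo hh.ne]
  rw [hcl] at hQU
  have hFc : IsCompact (closure F) := hFb.isCompact_closure
  have hK : IsCompact (closure F ×ˢ Icc 0 h) := hFc.prod isCompact_Icc
  have hvc : ContinuousOn v (closure F ×ˢ Icc 0 h) := hv.continuousOn.mono hQU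
  have hdc : ContinuousOn (fun x => fderiv ℝ v x ((0, 0), 1)) (closure F ×ˢ Icc 0 h) :=
    ((hv.continuousOn_fderiv_of_isOpen hU le_rfl).mono hQU).clm_apply continuousOn_const
  have hsub : F ×ˢ Ioo 0 h ⊆ closure F ×ˢ Icc 0 h :=
    prod_mono subset_closure Ioo_subset_Icc_self
  have hint : ∀ {f : (ℝ × ℝ) × ℝ → ℝ}, ContinuousOn f (closure F ×ˢ Icc 0 h) →
      IntegrableOn (fun x => |f x| ^ p) (F ×ˢ Ioo 0 h) (volume.prod volume) := fun hf =>
    ((hf.abs.rpow_const fun _ _ => Or.inr hp0).integrableOn_compact hK).mono_set hsub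
  have hslice : ∀ {f : (ℝ × ℝ) × ℝ → ℝ}, ContinuousOn f (closure F ×ˢ Icc 0 h) →
      IntegrableOn (fun y => ∫ t in Ioo 0 h, |f (y, t)| ^ p) F := by
    intro f hf
    have := hint hf
    rw [IntegrableOn, ← Measure.prod_restrict] at this
    exact this.integral_prod_left
  have hbot : IntegrableOn (fun y => |v (y, 0)| ^ p) F := by
    have hc : ContinuousOn (fun y => v (y, 0)) (closure F) :=
      hvc.comp (by fun_prop) fun y hy => ⟨hy, left_mem_Icc.2 hh.le⟩
    exact ((hc.abs.rpow_const fun _ _ => Or.inr hp0).integrableOn_compact hFc).mono_set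
      subset_closure
  rw [Measure.volume_eq_prod (ℝ × ℝ) ℝ, setIntegral_prod _ (hint hvc),
    setIntegral_prod _ (hint hdc), ← integral_const_mul,
    ← integral_add (hslice hvc) ((hslice hdc).const_mul _), ← integral_const_mul]
  refine setIntegral_mono_on hbot
    (((hslice hvc).add ((hslice hdc).const_mul _)).const_mul _) hF fun y hy => ?_
  have hmem : ∀ t ∈ Icc 0 h, (y, t) ∈ closure F ×ˢ Icc 0 h := fun t ht => ⟨subset_closure hy, ht⟩
  refine rpow_abs_apply_zero_le (g := fun t => v (y, t)) hp hh (fun t ht => ?_)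
    (hdc.comp (by fun_prop) hmem)
  have hd : HasFDerivAt v (fderiv ℝ v (y, t)) (y, t) :=
    ((hv.contDiffAt (hU.mem_nhds (hQU (hmem t ht)))).differentiableAt one_ne_zero).hasFDerivAt
  exact hd.comp_hasDerivAt t ((hasDerivAt_const t y).prodMk (hasDerivAt_id t))
end

section
/- There exists an absolute constant C such that for every nondegenerate triangle ξ ⊂ ℝ² with vertices a, b, c and every function v continuously differentiable on a neighborhood of the closure of ξ one has ∫_{[a,b]} |v| dH¹ ≤ C (‖b−a‖ / |ξ|) ( ∫_ξ |v| + ∫_ξ |∇v · (b−a)| + ∫_ξ |∇v · (c−a)| ), where [a,b] is the closed segment from a to b with one-dimensional Hausdorff (arclength) measure H¹, |ξ| is the area of ξ, and ∇v · w denotes the directional derivative of v along the vector w. -/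
open MeasureTheory Set

/-- The reference triangle with vertices `(0, 0)`, `(1, 0)`, `(0, 1)`. -/
def refTriangle : Set (ℝ × ℝ) := convexHull ℝ {(0, 0), (1, 0), (0, 1)}

lemma isCompact_refTriangle : IsCompact refTriangle :=
  Set.Finite.isCompact_convexHull ℝ (by simp)

lemma mem_refTriangle {s t : ℝ} (hs : 0 ≤ s) (ht : 0 ≤ t) (hst : s + t ≤ 1) :
    (s, t) ∈ refTriangle := by
  rw [refTriangle, convexHull_insert (by simp), convexHull_pair, mem_convexJoin]
  refine ⟨(0, 0), rfl, ?_⟩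
  rcases eq_or_lt_of_le (add_nonneg hs ht) with h | h
  · have h1 : s = 0 := by linarith
    have h2 : t = 0 := by linarith
    subst h1 h2
    exact ⟨(1, 0), left_mem_segment _ _ _, left_mem_segment _ _ _⟩
  · refine ⟨(s / (s + t), t / (s + t)), ⟨s / (s + t), t / (s + t), by positivity, by positivity,
      by field_simp, by simp⟩, ⟨1 - (s + t), s + t, by linarith, h.le, by ring, ?_⟩⟩
    ext <;> simp <;> field_simp

lemma refTriangle_subset_Icc : refTriangle ⊆ Icc 0 1 ×ˢ Icc 0 1 := by
  refine convexHull_min ?_ ((convex_Icc _ _).prod (convex_Icc _ _))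
  rintro p (rfl | rfl | rfl) <;> simp

/-- One-dimensional trace inequality at the left endpoint of `[0, 1/2]`. -/
lemma abs_apply_zero_le_integral {φ φ' : ℝ → ℝ}
    (h : ∀ t ∈ Icc (0 : ℝ) (1 / 2), HasDerivAt φ (φ' t) t)
    (h' : ContinuousOn φ' (Icc 0 (1 / 2))) :
    |φ 0| ≤ ∫ t in (0 : ℝ)..(1 / 2), (2 * |φ t| + |φ' t|) := by
  have hφ : ContinuousOn φ (Icc 0 (1 / 2)) := fun t ht => (h t ht).continuousAt.continuousWithinAt
  have hu : uIcc (0 : ℝ) (1 / 2) = Icc 0 (1 / 2) := uIcc_of_le (by norm_num)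
  have iφ : IntervalIntegrable (fun t => |φ t|) volume 0 (1 / 2) :=
    ContinuousOn.intervalIntegrable (hu ▸ hφ.abs)
  have iφ' : IntervalIntegrable (fun t => |φ' t|) volume 0 (1 / 2) :=
    ContinuousOn.intervalIntegrable (hu ▸ h'.abs)
  set A := ∫ t in (0 : ℝ)..(1 / 2), |φ' t| with hA
  have key : ∀ t ∈ Icc (0 : ℝ) (1 / 2), |φ 0| ≤ |φ t| + A := by
    intro t ht
    have hsub : Icc (0 : ℝ) t ⊆ Icc 0 (1 / 2) := Icc_subset_Icc_right ht.2
    have hut : uIcc (0 : ℝ) t = Icc 0 t := uIcc_of_le ht.1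
    have e : ∫ x in (0 : ℝ)..t, φ' x = φ t - φ 0 :=
      intervalIntegral.integral_eq_sub_of_hasDerivAt (fun x hx => h x (hsub (hut ▸ hx)))
        (ContinuousOn.intervalIntegrable (hut ▸ h'.mono hsub))
    have e1 : |φ t - φ 0| ≤ ∫ x in (0 : ℝ)..t, |φ' x| :=
      e ▸ intervalIntegral.abs_integral_le_integral_abs ht.1
    have e2 : ∫ x in (0 : ℝ)..t, |φ' x| ≤ A :=
      intervalIntegral.integral_mono_interval le_rfl ht.1 ht.2
        (Filter.Eventually.of_forall fun x => abs_nonneg _) iφ'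
    have e3 := abs_sub_abs_le_abs_sub (φ 0) (φ t)
    rw [abs_sub_comm] at e3
    linarith
  have m := intervalIntegral.integral_mono_on (a := 0) (b := 1 / 2) (μ := volume) (by norm_num)
    (f := fun _ => |φ 0|) (g := fun t => |φ t| + A) (by simp) (iφ.add (by simp)) key
  rw [intervalIntegral.integral_add iφ (by simp)] at m
  simp only [intervalIntegral.integral_const, smul_eq_mul] at m
  rw [intervalIntegral.integral_add (iφ.const_mul 2) iφ', intervalIntegral.integral_const_mul]
  linarith

/-- The Duffy map `(s, t) ↦ (s * (1 - t), t)`, restricted to `t ≤ 1/2`, shrinks areas at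
most by a factor of two. -/
lemma integral_duffy_le {h : ℝ × ℝ → ℝ} (hc : ContinuousOn h refTriangle) (h0 : ∀ p, 0 ≤ h p) :
    ∫ s in Icc (0 : ℝ) 1, ∫ t in Icc (0 : ℝ) (1 / 2), h (s * (1 - t), t) ≤
      2 * ∫ p in refTriangle, h p := by
  have hm : MeasurableSet refTriangle := isCompact_refTriangle.measurableSet
  have hi : Integrable (refTriangle.indicator h) (volume.prod volume) := by
    rw [← Measure.volume_eq_prod, integrable_indicator_iff hm]
    exact hc.integrableOn_compact isCompact_refTriangle
  have hd : ContinuousOn (fun p : ℝ × ℝ => h (p.1 * (1 - p.2), p.2))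
      (Icc (0 : ℝ) 1 ×ˢ Icc (0 : ℝ) (1 / 2)) := by
    refine hc.comp (by fun_prop) ?_
    rintro ⟨s, t⟩ ⟨⟨hs, hs'⟩, ht, ht'⟩
    dsimp only at *
    exact mem_refTriangle (by nlinarith) ht (by nlinarith)
  have hdi : Integrable (Function.uncurry fun s t : ℝ => h (s * (1 - t), t))
      ((volume.restrict (Icc (0 : ℝ) 1)).prod (volume.restrict (Icc (0 : ℝ) (1 / 2)))) := by
    rw [Measure.prod_restrict]
    exact hd.integrableOn_compact (isCompact_Icc.prod isCompact_Icc)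
  have hind : ∀ p, 0 ≤ refTriangle.indicator h p := indicator_nonneg fun p _ => h0 p
  rw [integral_integral_swap hdi, ← integral_indicator hm, Measure.volume_eq_prod,
    integral_prod_symm _ hi, ← integral_const_mul]
  refine le_trans ?_ (setIntegral_le_integral (s := Icc (0 : ℝ) (1 / 2))
    (hi.integral_prod_right.const_mul 2)
    (Filter.Eventually.of_forall fun t =>
      mul_nonneg zero_le_two (integral_nonneg fun s => hind (s, t))))
  refine setIntegral_mono_on_ae hdi.integral_prod_right
    (hi.integral_prod_right.const_mul 2).integrableOn measurableSet_Icc ?_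
  filter_upwards [hi.prod_left_ae] with t hit ht
  have hpos : 0 < 1 - t := by linarith [ht.2]
  have e1 : ∫ s in Icc (0 : ℝ) 1, h (s * (1 - t), t) =
      (1 - t)⁻¹ * ∫ s in Icc 0 (1 - t), h (s, t) := by
    rw [integral_Icc_eq_integral_Ioc, ← intervalIntegral.integral_of_le zero_le_one,
      intervalIntegral.integral_comp_mul_right (fun s => h (s, t)) hpos.ne', zero_mul, one_mul,
      intervalIntegral.integral_of_le hpos.le, integral_Icc_eq_integral_Ioc, smul_eq_mul]
  have e2 : ∫ s in Icc 0 (1 - t), h (s, t) ≤ ∫ s, refTriangle.indicator h (s, t) := by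
    rw [setIntegral_congr_fun (g := fun s => refTriangle.indicator h (s, t)) measurableSet_Icc
      fun s hs => (indicator_of_mem (mem_refTriangle hs.1 ht.1 (by linarith [hs.2])) h).symm]
    exact setIntegral_le_integral hit (Filter.Eventually.of_forall fun s => hind (s, t))
  rw [e1]
  refine mul_le_mul ?_ e2 (integral_nonneg fun s => h0 _) zero_le_two
  rw [inv_le_comm₀ hpos two_pos]
  linarith [ht.2]

/-- Arclength integral over a segment, in the affine parametrization. -/
lemma setIntegral_segment_hausdorffMeasure {E : Type*} [NormedAddCommGroup E] [NormedSpace ℝ E]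
    [MeasurableSpace E] [BorelSpace E] {a b : E} (hab : a ≠ b) (f : E → ℝ) :
    ∫ x in segment ℝ a b, f x ∂μH[1] =
      ‖b - a‖ * ∫ s in Icc (0 : ℝ) 1, f (a + s • (b - a)) := by
  have hn : 0 < ‖b - a‖ := norm_pos_iff.2 (sub_ne_zero.2 hab.symm)
  set e : ℝ → E := fun r => a + (r * ‖b - a‖⁻¹) • (b - a) with he
  have hiso : Isometry e := by
    refine Isometry.of_dist_eq fun x y => ?_
    rw [he, dist_add_left, dist_eq_norm, dist_eq_norm, ← sub_smul, ← sub_mul, norm_smul, norm_mul,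
      norm_inv, norm_norm, inv_mul_cancel_right₀ hn.ne']
  have hemb : MeasurableEmbedding e := hiso.isClosedEmbedding.measurableEmbedding
  have himg : segment ℝ a b = e '' Icc 0 ‖b - a‖ := by
    rw [segment_eq_image']
    ext x
    constructor
    · rintro ⟨θ, hθ, rfl⟩
      refine ⟨θ * ‖b - a‖, ⟨by have := hθ.1; positivity, by nlinarith [hθ.2]⟩, ?_⟩
      simp only [he, mul_inv_cancel_right₀ hn.ne']
    · rintro ⟨r, hr, rfl⟩
      exact ⟨r * ‖b - a‖⁻¹, ⟨by have := hr.1; positivity,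
        by rw [← div_eq_mul_inv, div_le_one hn]; exact hr.2⟩, rfl⟩
  have hmap : (μH[1] : Measure E).restrict (segment ℝ a b) =
      (Measure.map e volume).restrict (segment ℝ a b) := by
    rw [← hausdorffMeasure_real, hiso.map_hausdorffMeasure (Or.inl zero_le_one),
      Measure.restrict_restrict_of_subset (himg ▸ image_subset_range _ _)]
  rw [hmap, hemb.setIntegral_map, himg, hiso.injective.preimage_image,
    integral_Icc_eq_integral_Ioc, ← intervalIntegral.integral_of_le hn.le,
    integral_Icc_eq_integral_Ioc, ← intervalIntegral.integral_of_le zero_le_one]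
  simp only [he]
  rw [intervalIntegral.integral_comp_mul_right (fun s => f (a + s • (b - a))) (inv_ne_zero hn.ne'),
    zero_mul, mul_inv_cancel₀ hn.ne', inv_inv, smul_eq_mul]

/-- An injective affine map between spaces of the same dimension scales Lebesgue integrals by a
positive constant. -/
lemma exists_setIntegral_image_eq_mul {E F : Type*} [NormedAddCommGroup E] [NormedSpace ℝ E]
    [FiniteDimensional ℝ E] [MeasurableSpace E] [BorelSpace E]
    [NormedAddCommGroup F] [NormedSpace ℝ F] [FiniteDimensional ℝ F] [MeasurableSpace F]
    [BorelSpace F] (μ : Measure E) [μ.IsAddHaarMeasure] (ν : Measure F) [ν.IsAddHaarMeasure]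
    (L : E ≃L[ℝ] F) (a : F) :
    ∃ κ : ℝ, 0 < κ ∧ ∀ (S : Set E) (f : F → ℝ),
      ∫ x in (fun p => a + L p) '' S, f x ∂ν = κ * ∫ p in S, f (a + L p) ∂μ := by
  have hh : (Measure.map L μ).IsAddHaarMeasure := L.isAddHaarMeasure_map μ
  have hmap : Measure.map (fun p => a + L p) μ = Measure.map L μ := by
    rw [← map_add_left_eq_self (Measure.map L μ) a,
      Measure.map_map (measurable_const_add a) L.continuous.measurable]
    rfl
  refine ⟨ν.addHaarScalarFactor (Measure.map L μ),
    Measure.addHaarScalarFactor_pos_of_isAddHaarMeasure _ _, fun S f => ?_⟩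
  have hemb : MeasurableEmbedding fun p => a + L p :=
    (measurableEmbedding_addLeft a).comp L.toHomeomorph.measurableEmbedding
  have hν := Measure.isAddLeftInvariant_eq_smul ν (Measure.map L μ)
  generalize ν.addHaarScalarFactor (Measure.map L μ) = κ at hν ⊢
  rw [hν, ← hmap, Measure.restrict_smul, integral_smul_nnreal_measure, hemb.setIntegral_map,
    hemb.injective.preimage_image]
  rfl

lemma volume_refTriangle_mem_Ioc : volume.real refTriangle ∈ Ioc (0 : ℝ) 1 := by
  constructor
  · have hsub : Icc (0 : ℝ) (1 / 2) ×ˢ Icc (0 : ℝ) (1 / 2) ⊆ refTriangle := by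
      rintro ⟨s, t⟩ ⟨⟨hs, hs'⟩, ht, ht'⟩
      exact mem_refTriangle hs ht (by dsimp only at *; linarith)
    refine lt_of_lt_of_le ?_ (measureReal_mono hsub isCompact_refTriangle.measure_lt_top.ne)
    rw [Measure.volume_eq_prod, measureReal_prod_prod]
    norm_num
  · refine (measureReal_mono refTriangle_subset_Icc
      (isCompact_Icc.prod isCompact_Icc).measure_lt_top.ne).trans ?_
    rw [Measure.volume_eq_prod, measureReal_prod_prod]
    simp

/-- The trace inequality pulled back to the reference triangle: `v` is composed with the affine
map `(s, t) ↦ a + s • u + t • w`. -/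
lemma integral_edge_le_integral_refTriangle {E : Type*} [NormedAddCommGroup E] [NormedSpace ℝ E]
    {v : E → ℝ} {U : Set E} (hU : IsOpen U) (hv : ContDiffOn ℝ 1 v U) (a u w : E)
    (hsub : ∀ p ∈ refTriangle, a + (p.1 • u + p.2 • w) ∈ U) :
    ∫ s in Icc (0 : ℝ) 1, |v (a + s • u)| ≤
      2 * ∫ p in refTriangle, (2 * |v (a + (p.1 • u + p.2 • w))| +
        (|fderiv ℝ v (a + (p.1 • u + p.2 • w)) u| + |fderiv ℝ v (a + (p.1 • u + p.2 • w)) w|)) := by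
  have hT : ContinuousOn (fun p : ℝ × ℝ => a + (p.1 • u + p.2 • w)) refTriangle := by fun_prop
  have hvT := hv.continuousOn.comp hT hsub
  have hDT := (hv.continuousOn_fderiv_of_isOpen hU le_rfl).comp hT hsub
  set h : ℝ × ℝ → ℝ := fun p => 2 * |v (a + (p.1 • u + p.2 • w))| +
    (|fderiv ℝ v (a + (p.1 • u + p.2 • w)) u| + |fderiv ℝ v (a + (p.1 • u + p.2 • w)) w|) with hh
  have hc : ContinuousOn h refTriangle :=
    (hvT.abs.const_mul 2).add
      ((hDT.clm_apply continuousOn_const).abs.add (hDT.clm_apply continuousOn_const).abs)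
  have h0 : ∀ p, 0 ≤ h p := fun p => by positivity
  have hmem : ∀ s ∈ Icc (0 : ℝ) 1, ∀ t ∈ Icc (0 : ℝ) (1 / 2),
      (s * (1 - t), t) ∈ refTriangle := by
    rintro s ⟨hs, hs'⟩ t ⟨ht, ht'⟩
    exact mem_refTriangle (by nlinarith) ht (by nlinarith)
  refine le_trans ?_ (integral_duffy_le hc h0)
  have hdi : Integrable (fun p : ℝ × ℝ => h (p.1 * (1 - p.2), p.2))
      ((volume.restrict (Icc (0 : ℝ) 1)).prod (volume.restrict (Icc (0 : ℝ) (1 / 2)))) := by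
    rw [Measure.prod_restrict]
    exact (hc.comp (by fun_prop) fun p hp => hmem _ hp.1 _ hp.2).integrableOn_compact
      (isCompact_Icc.prod isCompact_Icc)
  have hedge : ContinuousOn (fun s : ℝ => |v (a + s • u)|) (Icc 0 1) :=
    (hv.continuousOn.comp (by fun_prop) fun s hs => by
      simpa using hsub (s, 0) (mem_refTriangle hs.1 le_rfl (by linarith [hs.2]))).abs
  refine setIntegral_mono_on (hedge.integrableOn_compact isCompact_Icc) hdi.integral_prod_left
    measurableSet_Icc fun s hs => ?_
  set γ : ℝ → E := fun t => a + ((s * (1 - t)) • u + t • w) with hγ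
  have hγU : ∀ t ∈ Icc (0 : ℝ) (1 / 2), γ t ∈ U := fun t ht => hsub _ (hmem s hs t ht)
  have hγ' : ∀ t, HasDerivAt γ (-(s • u) + w) t := fun t => by
    have h1 : HasDerivAt (fun t : ℝ => s * (1 - t)) (-s) t := by
      simpa using ((hasDerivAt_id t).const_sub 1).const_mul s
    have h2 := ((h1.smul_const u).fun_add ((hasDerivAt_id t).smul_const w)).const_add a
    simpa only [neg_smul, one_smul, id] using h2
  have hder : ∀ t ∈ Icc (0 : ℝ) (1 / 2),
      HasDerivAt (v ∘ γ) (fderiv ℝ v (γ t) (-(s • u) + w)) t := fun t ht =>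
    (((hv.differentiableOn one_ne_zero).differentiableAt
      (hU.mem_nhds (hγU t ht))).hasFDerivAt).comp_hasDerivAt t (hγ' t)
  have hγc : Continuous γ := by fun_prop
  have hder' : ContinuousOn (fun t => fderiv ℝ v (γ t) (-(s • u) + w)) (Icc 0 (1 / 2)) :=
    ((hv.continuousOn_fderiv_of_isOpen hU le_rfl).comp hγc.continuousOn hγU).clm_apply
      continuousOn_const
  have key := abs_apply_zero_le_integral hder hder'
  rw [intervalIntegral.integral_of_le (by norm_num), ← integral_Icc_eq_integral_Ioc] at key
  have hstart : γ 0 = a + s • u := by simp [hγ]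
  rw [Function.comp_apply, hstart] at key
  have hvγ : ContinuousOn (v ∘ γ) (Icc 0 (1 / 2)) :=
    hv.continuousOn.comp hγc.continuousOn hγU
  refine key.trans (setIntegral_mono_on
    (((hvγ.abs.const_mul 2).add hder'.abs).integrableOn_compact isCompact_Icc)
    ((hc.comp (f := fun t : ℝ => (s * (1 - t), t)) (by fun_prop)
      (hmem s hs)).integrableOn_compact isCompact_Icc) measurableSet_Icc fun t _ => ?_)
  refine add_le_add_right ?_ _
  rw [map_add, map_neg, map_smul, smul_eq_mul]
  refine (abs_add_le _ _).trans (add_le_add_left ?_ _)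
  rw [abs_neg, abs_mul, abs_of_nonneg hs.1]
  exact mul_le_of_le_one_left (abs_nonneg _) hs.2

/-- The linear isomorphism `(s, t) ↦ s • u + t • w` onto a plane with basis `u, w`. -/
lemma exists_continuousLinearEquiv_prod {E : Type*} [NormedAddCommGroup E] [NormedSpace ℝ E]
    [FiniteDimensional ℝ E] (hE : Module.finrank ℝ E = 2) {u w : E}
    (h : LinearIndependent ℝ ![u, w]) :
    ∃ L : (ℝ × ℝ) ≃L[ℝ] E, ∀ p, L p = p.1 • u + p.2 • w := by
  let f : ℝ × ℝ →ₗ[ℝ] E :=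
    (LinearMap.toSpanSingleton ℝ E u).coprod (LinearMap.toSpanSingleton ℝ E w)
  have hf : Function.Injective f := by
    rw [← LinearMap.ker_eq_bot, LinearMap.ker_eq_bot']
    rintro ⟨s, t⟩ hst
    obtain ⟨rfl, rfl⟩ := LinearIndependent.pair_iff.1 h s t (by simpa [f] using hst)
    rfl
  exact ⟨(LinearMap.linearEquivOfInjective f hf (by simp [hE])).toContinuousLinearEquiv,
    fun p => by simp [f]⟩

/-- Anisotropic trace inequality on a triangle `ξ = conv{a,b,c} ⊂ ℝ²`:
`∫_{[a,b]} |v| dH¹ ≤ C (‖b−a‖/|ξ|) (∫_ξ |v| + ∫_ξ |∇v·(b−a)| + ∫_ξ |∇v·(c−a)|)`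
with an absolute constant `C`, the derivative terms being directional derivatives
along the two (unnormalized) edge vectors emanating from `a`. -/
theorem anisotropic_trace_on_triangle_edge :
    ∃ C : ℝ, 0 < C ∧
      ∀ a b c : EuclideanSpace ℝ (Fin 2),
        AffineIndependent ℝ ![a, b, c] →
      ∀ v : EuclideanSpace ℝ (Fin 2) → ℝ,
        (∃ U : Set (EuclideanSpace ℝ (Fin 2)), IsOpen U ∧
          closure (convexHull ℝ {a, b, c}) ⊆ U ∧ ContDiffOn ℝ 1 v U) →
        (∫ x in segment ℝ a b, |v x| ∂μH[1]) ≤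
          C * (‖b - a‖ / (volume (convexHull ℝ {a, b, c} : Set _)).toReal) *
            ((∫ x in convexHull ℝ {a, b, c}, |v x|) +
              (∫ x in convexHull ℝ {a, b, c}, |fderiv ℝ v x (b - a)|) +
              ∫ x in convexHull ℝ {a, b, c}, |fderiv ℝ v x (c - a)|) := by
  refine ⟨4, by norm_num, fun a b c habc v ⟨U, hU, hξU, hv⟩ => ?_⟩
  have hli : LinearIndependent ℝ ![b - a, c - a] := by
    have h := (affineIndependent_iff_linearIndependent_vsub ℝ ![a, b, c] 0).1 habc
    let g : Fin 2 → {x : Fin 3 // x ≠ 0} := fun i => ⟨i.succ, i.succ_ne_zero⟩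
    have hg : Function.Injective g := fun i j hij =>
      Fin.succ_injective _ (Subtype.ext_iff.1 hij)
    have e : ![b - a, c - a] =
        (fun i : {x : Fin 3 // x ≠ 0} => ![a, b, c] i -ᵥ ![a, b, c] 0) ∘ g := by
      funext i
      fin_cases i <;> simp [g]
    rw [e]
    exact h.comp g hg
  have hab : a ≠ b := fun h => hli.ne_zero 0 (by simp [h])
  obtain ⟨L, hL⟩ := exists_continuousLinearEquiv_prod (by simp) hli
  obtain ⟨κ, hκ, hint⟩ := exists_setIntegral_image_eq_mul (volume : Measure (ℝ × ℝ))
    (volume : Measure (EuclideanSpace ℝ (Fin 2))) L a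
  have himg : convexHull ℝ {a, b, c} = (fun p => a + L p) '' refTriangle := by
    have h := (AffineMap.const ℝ (ℝ × ℝ) a + L.toLinearMap.toAffineMap).image_convexHull
      {(0, 0), (1, 0), (0, 1)}
    rw [image_insert_eq, image_pair] at h
    refine Eq.trans ?_ h.symm
    simp [hL]
  have hcomp : IsCompact (convexHull ℝ {a, b, c}) := Set.Finite.isCompact_convexHull ℝ (by simp)
  have hξ : convexHull ℝ {a, b, c} ⊆ U := subset_closure.trans hξU
  have hvi : IntegrableOn (fun x => |v x|) (convexHull ℝ {a, b, c}) :=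
    (hv.continuousOn.mono hξ).abs.integrableOn_compact hcomp
  have hDi : ∀ z, IntegrableOn (fun x => |fderiv ℝ v x z|) (convexHull ℝ {a, b, c}) := fun z =>
    ((((hv.continuousOn_fderiv_of_isOpen hU le_rfl).mono hξ).clm_apply
      continuousOn_const).abs).integrableOn_compact hcomp
  have hvol : volume.real (convexHull ℝ {a, b, c}) = κ * volume.real refTriangle := by
    simpa [← himg] using hint refTriangle fun _ => 1
  have htr := integral_edge_le_integral_refTriangle hU hv a (b - a) (c - a) fun p hp => by
    rw [← hL]
    exact hξ (himg ▸ mem_image_of_mem _ hp)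
  have hH := hint refTriangle fun x =>
    2 * |v x| + (|fderiv ℝ v x (b - a)| + |fderiv ℝ v x (c - a)|)
  rw [← himg, integral_add (hvi.const_mul 2) (Integrable.fun_add (hDi _) (hDi _)),
    integral_add (hDi _) (hDi _), integral_const_mul] at hH
  simp only [hL] at hH
  rw [setIntegral_segment_hausdorffMeasure hab, ← measureReal_def, hvol]
  obtain ⟨hm0, hm1⟩ := volume_refTriangle_mem_Ioc
  set m := volume.real refTriangle
  set I := ∫ p in refTriangle, (2 * |v (a + (p.1 • (b - a) + p.2 • (c - a)))| +
    (|fderiv ℝ v (a + (p.1 • (b - a) + p.2 • (c - a))) (b - a)| +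
      |fderiv ℝ v (a + (p.1 • (b - a) + p.2 • (c - a))) (c - a)|))
  set A := ∫ x in convexHull ℝ {a, b, c}, |v x|
  have hB : 0 ≤ ∫ x in convexHull ℝ {a, b, c}, |fderiv ℝ v x (b - a)| :=
    integral_nonneg fun _ => abs_nonneg _
  have hC : 0 ≤ ∫ x in convexHull ℝ {a, b, c}, |fderiv ℝ v x (c - a)| :=
    integral_nonneg fun _ => abs_nonneg _
  have hA : 0 ≤ A := integral_nonneg fun _ => abs_nonneg _
  set B := ∫ x in convexHull ℝ {a, b, c}, |fderiv ℝ v x (b - a)|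
  set D := ∫ x in convexHull ℝ {a, b, c}, |fderiv ℝ v x (c - a)|
  have hI : 2 * I ≤ 4 * (A + B + D) / (κ * m) := by
    rw [le_div_iff₀ (mul_pos hκ hm0)]
    have hI0 : 0 ≤ κ * I := by rw [← hH]; positivity
    nlinarith [mul_le_of_le_one_right hI0 hm1]
  calc ‖b - a‖ * ∫ s in Icc (0 : ℝ) 1, |v (a + s • (b - a))|
      ≤ ‖b - a‖ * (4 * (A + B + D) / (κ * m)) :=
        mul_le_mul_of_nonneg_left (htr.trans hI) (norm_nonneg _)
    _ = 4 * (‖b - a‖ / (κ * m)) * (A + B + D) := by ring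
end

section
/- Let l, H > 0, let P = (0,l) × (0,H) ⊂ ℝ², let z₀ ∈ [0,H], and let v be continuously differentiable on a neighborhood of the closure of P with v(0,z) = 0 for all z ∈ [0,H]. Then ∫₀^l |v(t,z₀)| dt ≤ (l/H) ∫_P |∂₁v| + ∫_P |∂₂v|, where ∂₁, ∂₂ denote the partial derivatives with respect to the first and second variable. -/
open MeasureTheory Set

/-- The increment of a `C¹` function between two points of `[0,L]` is at most the total
variation over `[0,L]`. -/
lemma abs_sub_le_integral_abs_deriv {f f' : ℝ → ℝ} {L : ℝ}
    (hf : ∀ x ∈ Icc 0 L, HasDerivAt f (f' x) x) (hf' : ContinuousOn f' (Icc 0 L))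
    {a b : ℝ} (ha : a ∈ Icc 0 L) (hb : b ∈ Icc 0 L) :
    |f b - f a| ≤ ∫ x in (0:ℝ)..L, |f' x| := by
  wlog hab : a ≤ b generalizing a b
  · rw [abs_sub_comm]
    exact this hb ha (le_of_not_ge hab)
  have hL : (0:ℝ) ≤ L := ha.1.trans ha.2
  have hsub : uIcc a b ⊆ Icc 0 L := by
    rw [uIcc_of_le hab]
    exact Icc_subset_Icc ha.1 hb.2
  rw [← intervalIntegral.integral_eq_sub_of_hasDerivAt (fun x hx => hf x (hsub hx))
    (hf'.mono hsub).intervalIntegrable]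
  refine (intervalIntegral.abs_integral_le_integral_abs hab).trans ?_
  refine intervalIntegral.integral_mono_interval ha.1 hab hb.2
    (Filter.Eventually.of_forall fun x => abs_nonneg _) ?_
  refine ContinuousOn.intervalIntegrable ?_
  rw [uIcc_of_le hL]
  exact hf'.abs

/-- Fubini on an open rectangle for a function continuous on the closed rectangle, with the
integrability of the inner integral as a function of the first variable. -/
lemma setIntegral_rectangle_eq {g : ℝ × ℝ → ℝ} {l H : ℝ} (hl : 0 ≤ l) (hH : 0 ≤ H)
    (hg : ContinuousOn g (Icc 0 l ×ˢ Icc 0 H)) :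
    IntervalIntegrable (fun t => ∫ z in (0:ℝ)..H, g (t, z)) volume 0 l ∧
      ∫ x in Ioo 0 l ×ˢ Ioo 0 H, g x = ∫ t in (0:ℝ)..l, ∫ z in (0:ℝ)..H, g (t, z) := by
  have hint : IntegrableOn g (Ioo 0 l ×ˢ Ioo 0 H) (volume.prod volume) :=
    (hg.integrableOn_compact (isCompact_Icc.prod isCompact_Icc)).mono_set
      (prod_mono Ioo_subset_Icc_self Ioo_subset_Icc_self)
  constructor
  · rw [intervalIntegrable_iff_integrableOn_Ioo_of_le hl]
    simp_rw [intervalIntegral.integral_of_le hH, integral_Ioc_eq_integral_Ioo]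
    rw [IntegrableOn, ← Measure.prod_restrict] at hint
    exact hint.integral_prod_left
  · simp_rw [intervalIntegral.integral_of_le hH, intervalIntegral.integral_of_le hl,
      integral_Ioc_eq_integral_Ioo]
    exact setIntegral_prod g hint

/-- Fubini on an open rectangle, integrating over the first variable first. -/
lemma setIntegral_rectangle_eq_swap {g : ℝ × ℝ → ℝ} {l H : ℝ} (hl : 0 ≤ l) (hH : 0 ≤ H)
    (hg : ContinuousOn g (Icc 0 l ×ˢ Icc 0 H)) :
    IntervalIntegrable (fun z => ∫ t in (0:ℝ)..l, g (t, z)) volume 0 H ∧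
      ∫ x in Ioo 0 l ×ˢ Ioo 0 H, g x = ∫ z in (0:ℝ)..H, ∫ t in (0:ℝ)..l, g (t, z) := by
  have hsw : ContinuousOn (g ∘ Prod.swap) (Icc 0 H ×ˢ Icc 0 l) :=
    hg.comp continuous_swap.continuousOn fun x hx => ⟨hx.2, hx.1⟩
  obtain ⟨h1, h2⟩ := setIntegral_rectangle_eq hH hl hsw
  refine ⟨h1, Eq.trans ?_ h2⟩
  exact (setIntegral_prod_swap (μ := volume) (ν := volume) (Ioo 0 l) (Ioo 0 H) g).symm

/-- Combined trace/Poincaré inequality on a rectangle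
`P = (0,l) × (0,H)` for a function vanishing on the left edge:
`∫₀^l |v(t,z₀)| dt ≤ (l/H) ∫_P |∂₁ v| + ∫_P |∂₂ v|` for every `z₀ ∈ [0,H]`. -/
theorem trace_poincare_on_rectangle :
    ∀ l H : ℝ, 0 < l → 0 < H →
    ∀ z₀ ∈ Icc (0:ℝ) H,
    ∀ v : ℝ × ℝ → ℝ,
      (∃ U : Set (ℝ × ℝ), IsOpen U ∧ closure (Ioo 0 l ×ˢ Ioo 0 H) ⊆ U ∧
        ContDiffOn ℝ 1 v U) →
      (∀ z ∈ Icc (0:ℝ) H, v (0, z) = 0) →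
      (∫ t in (0:ℝ)..l, |v (t, z₀)|) ≤
        (l / H) * (∫ x in Ioo 0 l ×ˢ Ioo 0 H, |fderiv ℝ v x (1, 0)|) +
          ∫ x in Ioo 0 l ×ˢ Ioo 0 H, |fderiv ℝ v x (0, 1)| := by
  rintro l H hl hH z₀ hz₀ v ⟨U, hU, hPU, hv⟩ hv0
  rw [closure_prod_eq, closure_Ioo hl.ne, closure_Ioo hH.ne] at hPU
  have hd : ∀ x ∈ Icc 0 l ×ˢ Icc 0 H, HasFDerivAt v (fderiv ℝ v x) x := fun x hx =>
    ((hv.differentiableOn one_ne_zero).differentiableAt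
      (hU.mem_nhds (hPU hx))).hasFDerivAt
  have hc : ContinuousOn (fderiv ℝ v) (Icc 0 l ×ˢ Icc 0 H) :=
    (hv.continuousOn_fderiv_of_isOpen hU le_rfl).mono hPU
  have hc' (w : ℝ × ℝ) : ContinuousOn (fun x => fderiv ℝ v x w) (Icc 0 l ×ˢ Icc 0 H) :=
    hc.clm_apply continuousOn_const
  obtain ⟨hi₁, he₁⟩ := setIntegral_rectangle_eq_swap hl.le hH.le (hc' (1, 0)).abs
  obtain ⟨hi₂, he₂⟩ := setIntegral_rectangle_eq hl.le hH.le (hc' (0, 1)).abs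
  have hhoriz : ∀ z ∈ Icc 0 H, ∀ t ∈ Icc 0 l,
      |v (t, z)| ≤ ∫ s in (0:ℝ)..l, |fderiv ℝ v (s, z) (1, 0)| := by
    intro z hz t ht
    have := abs_sub_le_integral_abs_deriv (f := fun s => v (s, z))
      (f' := fun s => fderiv ℝ v (s, z) (1, 0)) (L := l)
      (fun s hs => (hd (s, z) ⟨hs, hz⟩).comp_hasDerivAt s
        ((hasDerivAt_id s).prodMk (hasDerivAt_const s z)))
      ((hc' (1, 0)).comp (by fun_prop) fun s hs => ⟨hs, hz⟩)
      (left_mem_Icc.2 hl.le) ht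
    simpa [hv0 z hz] using this
  have hvert : ∀ t ∈ Icc 0 l, ∀ z ∈ Icc 0 H,
      |v (t, z₀) - v (t, z)| ≤ ∫ s in (0:ℝ)..H, |fderiv ℝ v (t, s) (0, 1)| := by
    intro t ht z hz
    exact abs_sub_le_integral_abs_deriv (f := fun s => v (t, s))
      (f' := fun s => fderiv ℝ v (t, s) (0, 1)) (L := H)
      (fun s hs => (hd (t, s) ⟨ht, hs⟩).comp_hasDerivAt s
        ((hasDerivAt_const s t).prodMk (hasDerivAt_id s)))
      ((hc' (0, 1)).comp (by fun_prop) fun s hs => ⟨ht, hs⟩) hz hz₀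
  rw [he₁, he₂]
  set A := ∫ z in (0:ℝ)..H, ∫ t in (0:ℝ)..l, |fderiv ℝ v (t, z) (1, 0)| with hA
  have hpt : ∀ t ∈ Icc 0 l,
      |v (t, z₀)| ≤ A / H + ∫ s in (0:ℝ)..H, |fderiv ℝ v (t, s) (0, 1)| := by
    intro t ht
    have h := intervalIntegral.integral_mono_on hH.le
      (f := fun _ => |v (t, z₀)| - ∫ s in (0:ℝ)..H, |fderiv ℝ v (t, s) (0, 1)|)
      intervalIntegrable_const hi₁ fun z hz => by
        have h1 := hhoriz z hz t ht
        have h2 := hvert t ht z hz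
        have h3 := abs_sub_abs_le_abs_sub (v (t, z₀)) (v (t, z))
        linarith
    rw [intervalIntegral.integral_const, smul_eq_mul, sub_zero, ← hA] at h
    rw [← sub_le_iff_le_add, le_div_iff₀ hH]
    linarith
  have hvint : IntervalIntegrable (fun t => |v (t, z₀)|) volume 0 l := by
    refine ContinuousOn.intervalIntegrable ?_
    rw [uIcc_of_le hl.le]
    exact ((hv.continuousOn.mono hPU).comp (by fun_prop) fun t ht => ⟨ht, hz₀⟩).abs
  have h := intervalIntegral.integral_mono_on hl.le hvint
    (intervalIntegrable_const.add hi₂) hpt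
  rw [intervalIntegral.integral_add intervalIntegrable_const hi₂,
    intervalIntegral.integral_const, smul_eq_mul, sub_zero] at h
  rwa [div_mul_eq_mul_div, ← mul_div_assoc']
end

section
/- There exists an absolute constant C such that for the reference tetrahedron T = conv{0, e₁, e₂, e₃} ⊂ ℝ³ (where e₁, e₂, e₃ are the standard basis vectors) and every function u twice continuously differentiable on a neighborhood of the closure of T one has ∫_{[0,e₁]} |u| dH¹ ≤ C ( ∫_T |u| + Σ_{1 ≤ |α| ≤ 2} ∫_T |∂^α u| ), where [0,e₁] is the edge from the origin to e₁ with arclength measure H¹, and the sum runs over all multi-indices α with 1 ≤ |α| ≤ 2, ∂^α denoting the corresponding partial derivative. -/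
open MeasureTheory Set

theorem lintegral_euclideanSpace_fin_three {G : EuclideanSpace ℝ (Fin 3) → ENNReal}
    (hG : Measurable G) :
    ∫⁻ x, G x = ∫⁻ x : ℝ, ∫⁻ s : ℝ, ∫⁻ r : ℝ, G !₂[x, s, r] := by
  have h₁ := (PiLp.volume_preserving_toLp (Fin 3)).lintegral_comp hG
  have h₂ := (volume_preserving_piFinSuccAbove (fun _ : Fin 3 => ℝ) 0).symm.lintegral_comp
    (hG.comp (WithLp.measurable_toLp 2 (Fin 3 → ℝ)))
  rw [← h₁]
  refine h₂.symm.trans ?_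
  rw [Measure.volume_eq_prod, lintegral_prod _ (by
    have := (hG.comp (WithLp.measurable_toLp 2 (Fin 3 → ℝ))).comp
      (MeasurableEquiv.piFinSuccAbove (fun _ : Fin 3 => ℝ) 0).symm.measurable
    exact this.aemeasurable)]
  refine lintegral_congr fun x => ?_
  have hm : Measurable fun p : ℝ × ℝ => G !₂[x, p.1, p.2] := by
    refine hG.comp ((WithLp.measurable_toLp 2 _).comp ?_)
    refine measurable_pi_lambda _ fun i => ?_
    fin_cases i <;> simp <;> fun_prop
  rw [← lintegral_prod (fun p : ℝ × ℝ => G !₂[x, p.1, p.2]) hm.aemeasurable,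
    ← Measure.volume_eq_prod, ← (volume_preserving_finTwoArrow ℝ).lintegral_comp hm]
  refine lintegral_congr fun q => ?_
  simp only [Function.comp_apply]
  congr 2
  ext i
  fin_cases i <;> rfl

theorem setLIntegral_comp_mul_le {c : ℝ} (hc : 1 / 2 ≤ c) (g : ℝ → ENNReal) (S : Set ℝ)
    (hS : MeasurableSet S) :
    ∫⁻ t in S, g (t * c) ≤ 2 * ∫⁻ x, g x := by
  have h := lintegral_image_eq_lintegral_abs_deriv_mul (f := fun t => t * c) (f' := fun _ => c) hS
    (fun x _ => by simpa using ((hasDerivAt_id x).mul_const c).hasDerivWithinAt)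
    (fun x _ y _ hxy => mul_right_cancel₀ (by linarith : c ≠ 0) hxy) g
  rw [lintegral_const_mul' _ _ ENNReal.ofReal_ne_top, abs_of_pos (by linarith)] at h
  have h1 : (1 : ENNReal) ≤ 2 * ENNReal.ofReal c := by
    rw [← ENNReal.ofReal_ofNat 2, ← ENNReal.ofReal_mul (by norm_num), ← ENNReal.ofReal_one]
    exact ENNReal.ofReal_le_ofReal (by linarith)
  calc ∫⁻ t in S, g (t * c) ≤ (2 * ENNReal.ofReal c) * ∫⁻ t in S, g (t * c) :=
        le_mul_of_one_le_left' h1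
    _ = 2 * ∫⁻ x in (fun t => t * c) '' S, g x := by rw [h, mul_assoc]
    _ ≤ _ := mul_le_mul' le_rfl (setLIntegral_le_lintegral _ _)

/-- The parallelograms with corner `t e₀` and sides along `e₁ - t e₀`, `e₂ - t e₀` do not overlap
much as `t` ranges over the edge. -/
theorem lintegral_fan_le {G : EuclideanSpace ℝ (Fin 3) → ENNReal} (hG : Measurable G) :
    ∫⁻ t in Icc (0 : ℝ) 1, ∫⁻ s in Icc (0 : ℝ) (1 / 4), ∫⁻ r in Icc (0 : ℝ) (1 / 4),
      G !₂[t * (1 - s - r), s, r] ≤ 2 * ∫⁻ x, G x := by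
  have hm : ∀ {α : Type} [MeasurableSpace α] {a b c : α → ℝ}, Measurable a → Measurable b →
      Measurable c → Measurable fun p => G !₂[a p, b p, c p] := by
    intro α _ a b c ha hb hc
    refine hG.comp ((WithLp.measurable_toLp 2 _).comp ?_)
    refine measurable_pi_lambda _ fun i => ?_
    fin_cases i <;> simpa
  rw [lintegral_lintegral_swap]
  swap
  · refine Measurable.aemeasurable (Measurable.lintegral_prod_right'
      (f := fun q : (ℝ × ℝ) × ℝ => G !₂[q.1.1 * (1 - q.1.2 - q.2), q.1.2, q.2]) ?_)
    exact hm (by fun_prop) (by fun_prop) (by fun_prop)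
  calc _ = ∫⁻ s in Icc (0 : ℝ) (1 / 4), ∫⁻ r in Icc (0 : ℝ) (1 / 4), ∫⁻ t in Icc (0 : ℝ) 1,
          G !₂[t * (1 - s - r), s, r] := by
        refine lintegral_congr fun s => lintegral_lintegral_swap (Measurable.aemeasurable ?_)
        exact hm (by fun_prop) (by fun_prop) (by fun_prop)
    _ ≤ ∫⁻ s in Icc (0 : ℝ) (1 / 4), ∫⁻ r in Icc (0 : ℝ) (1 / 4), 2 * ∫⁻ x, G !₂[x, s, r] := by
        refine setLIntegral_mono' measurableSet_Icc fun s hs =>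
          setLIntegral_mono' measurableSet_Icc fun r hr => ?_
        exact setLIntegral_comp_mul_le (by linarith [hs.2, hr.2]) (fun x => G !₂[x, s, r]) _
          measurableSet_Icc
    _ ≤ ∫⁻ s, ∫⁻ r, 2 * ∫⁻ x, G !₂[x, s, r] :=
        (setLIntegral_le_lintegral _ _).trans
          (lintegral_mono fun s => setLIntegral_le_lintegral _ _)
    _ = 2 * ∫⁻ x, G x := by
        simp_rw [lintegral_const_mul' _ _ ENNReal.ofNat_ne_top]
        rw [lintegral_euclideanSpace_fin_three hG]
        congr 1
        symm
        refine (lintegral_lintegral_swap (Measurable.aemeasurable ?_)).trans ?_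
        · refine Measurable.lintegral_prod_right'
            (f := fun q : (ℝ × ℝ) × ℝ => G !₂[q.1.1, q.1.2, q.2]) ?_
          exact hm (by fun_prop) (by fun_prop) (by fun_prop)
        · refine lintegral_congr fun s => lintegral_lintegral_swap (Measurable.aemeasurable ?_)
          exact hm (by fun_prop) (by fun_prop) (by fun_prop)

/-- One-dimensional trace inequality on `[0, 1/4]`. -/
theorem enorm_apply_zero_le_lintegral {g g' : ℝ → ℝ}
    (hg : ∀ x ∈ Icc (0 : ℝ) (1 / 4), HasDerivAt g (g' x) x)
    (hg' : ContinuousOn g' (Icc 0 (1 / 4))) :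
    ‖g 0‖ₑ ≤ 4 * ∫⁻ x in Icc (0 : ℝ) (1 / 4), (‖g x‖ₑ + ‖g' x‖ₑ) := by
  have hcont : ContinuousOn g (Icc 0 (1 / 4)) := fun x hx =>
    (hg x hx).continuousAt.continuousWithinAt
  have hvol : volume (Icc (0 : ℝ) (1 / 4)) = 4⁻¹ := by
    rw [Real.volume_Icc, sub_zero, one_div, ENNReal.ofReal_inv_of_pos (by norm_num),
      ENNReal.ofReal_ofNat]
  have key : ∀ s ∈ Icc (0 : ℝ) (1 / 4),
      ‖g 0‖ₑ ≤ ‖g s‖ₑ + ∫⁻ x in Icc (0 : ℝ) (1 / 4), ‖g' x‖ₑ := by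
    intro s hs
    have hsub : Icc 0 s ⊆ Icc (0 : ℝ) (1 / 4) := Icc_subset_Icc_right hs.2
    have hftc := intervalIntegral.integral_eq_sub_of_hasDerivAt (f := g) (f' := g')
      (a := 0) (b := s) (fun x hx => hg x (hsub (by rwa [uIcc_of_le hs.1] at hx)))
      ((hg'.mono (by rwa [uIcc_of_le hs.1])).intervalIntegrable)
    have h0 : g 0 = g s - ∫ y in (0 : ℝ)..s, g' y := by rw [hftc]; ring
    rw [h0]
    refine enorm_sub_le.trans (add_le_add_right ?_ _)
    rw [intervalIntegral.integral_of_le hs.1]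
    exact (enorm_integral_le_lintegral_enorm _).trans
      (lintegral_mono_set (Ioc_subset_Icc_self.trans hsub))
  have hint : ∫⁻ _ in Icc (0 : ℝ) (1 / 4), ‖g 0‖ₑ ≤
      ∫⁻ s in Icc (0 : ℝ) (1 / 4), (‖g s‖ₑ + ∫⁻ x in Icc (0 : ℝ) (1 / 4), ‖g' x‖ₑ) :=
    setLIntegral_mono' measurableSet_Icc key
  rw [setLIntegral_const, lintegral_add_right _ measurable_const, setLIntegral_const, hvol] at hint
  have h4 : (4 : ENNReal) * 4⁻¹ = 1 := ENNReal.mul_inv_cancel (by norm_num) (by norm_num)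
  rw [lintegral_add_right' _ (hg'.aemeasurable measurableSet_Icc).enorm]
  calc ‖g 0‖ₑ = 4 * (‖g 0‖ₑ * 4⁻¹) := by rw [mul_left_comm, h4, mul_one]
    _ ≤ _ := by
      gcongr
      refine hint.trans ?_
      gcongr
      exact mul_le_of_le_one_right' (by norm_num)

/-- Two-dimensional trace inequality at the corner of the square `[0, 1/4]²`. -/
theorem enorm_corner_le_lintegral {f fs fr fsr : ℝ → ℝ → ℝ}
    (hs : ∀ s ∈ Icc (0 : ℝ) (1 / 4), HasDerivAt (fun s => f s 0) (fs s 0) s)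
    (hr : ∀ s ∈ Icc (0 : ℝ) (1 / 4), ∀ r ∈ Icc (0 : ℝ) (1 / 4),
      HasDerivAt (fun r => f s r) (fr s r) r)
    (hsr : ∀ s ∈ Icc (0 : ℝ) (1 / 4), ∀ r ∈ Icc (0 : ℝ) (1 / 4),
      HasDerivAt (fun r => fs s r) (fsr s r) r)
    (hsc : ContinuousOn (fun s => fs s 0) (Icc 0 (1 / 4)))
    (hrc : ∀ s ∈ Icc (0 : ℝ) (1 / 4), ContinuousOn (fun r => fr s r) (Icc 0 (1 / 4)))
    (hsrc : ∀ s ∈ Icc (0 : ℝ) (1 / 4), ContinuousOn (fun r => fsr s r) (Icc 0 (1 / 4))) :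
    ‖f 0 0‖ₑ ≤ 16 * ∫⁻ s in Icc (0 : ℝ) (1 / 4), ∫⁻ r in Icc (0 : ℝ) (1 / 4),
      (‖f s r‖ₑ + ‖fr s r‖ₑ + (‖fs s r‖ₑ + ‖fsr s r‖ₑ)) := by
  have h16 : (16 : ENNReal) = 4 * 4 := by norm_num
  refine (enorm_apply_zero_le_lintegral hs hsc).trans ?_
  rw [h16, mul_assoc, ← lintegral_const_mul' 4 (fun s => ∫⁻ r in Icc (0 : ℝ) (1 / 4),
    (‖f s r‖ₑ + ‖fr s r‖ₑ + (‖fs s r‖ₑ + ‖fsr s r‖ₑ))) (by norm_num)]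
  gcongr 4 * ?_
  refine setLIntegral_mono' measurableSet_Icc fun s hs' => ?_
  have hfm : ContinuousOn (fun r => f s r) (Icc 0 (1 / 4)) := fun r hr' =>
    (hr s hs' r hr').continuousAt.continuousWithinAt
  rw [lintegral_add_left', mul_add]
  · exact add_le_add (enorm_apply_zero_le_lintegral (hr s hs') (hrc s hs'))
      (enorm_apply_zero_le_lintegral (hsr s hs') (hsrc s hs'))
  · exact (hfm.aemeasurable measurableSet_Icc).enorm.add
      ((hrc s hs').aemeasurable measurableSet_Icc).enorm

/-- The sum of the absolute values of `u` and of its partial derivatives of order at most two. -/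
noncomputable def derivativeSum (u : EuclideanSpace ℝ (Fin 3) → ℝ)
    (x : EuclideanSpace ℝ (Fin 3)) : ℝ :=
  |u x| + ((∑ i : Fin 3, |fderiv ℝ u x (EuclideanSpace.single i 1)|) +
    ∑ i : Fin 3, ∑ j : Fin 3,
      |iteratedFDeriv ℝ 2 u x ![EuclideanSpace.single i 1, EuclideanSpace.single j 1]|)

theorem derivativeSum_nonneg (u : EuclideanSpace ℝ (Fin 3) → ℝ)
    (x : EuclideanSpace ℝ (Fin 3)) : 0 ≤ derivativeSum u x := by
  unfold derivativeSum
  positivity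

theorem sum_fan_derivatives_le (u : EuclideanSpace ℝ (Fin 3) → ℝ) (x : EuclideanSpace ℝ (Fin 3))
    {t : ℝ} (ht : t ∈ Icc (0 : ℝ) 1) {v w : EuclideanSpace ℝ (Fin 3)}
    (hv : v = EuclideanSpace.single 1 1 - t • EuclideanSpace.single 0 1)
    (hw : w = EuclideanSpace.single 2 1 - t • EuclideanSpace.single 0 1) :
    |u x| + |fderiv ℝ u x w| + (|fderiv ℝ u x v| + |fderiv ℝ (fderiv ℝ u) x w v|) ≤
      2 * derivativeSum u x := by
  have hmul : ∀ a : ℝ, |t * a| ≤ |a| := fun a => by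
    rw [abs_mul, abs_of_nonneg ht.1]
    exact mul_le_of_le_one_left (abs_nonneg a) ht.2
  have hsub : ∀ a b : ℝ, |a - t * b| ≤ |a| + |b| := fun a b =>
    (abs_sub _ _).trans (add_le_add_right (hmul b) _)
  subst hv hw
  simp only [derivativeSum, iteratedFDeriv_two_apply, Fin.sum_univ_three, Matrix.cons_val_zero,
    Matrix.cons_val_one, map_sub, map_smul, _root_.sub_apply,
    _root_.smul_apply, smul_eq_mul]
  set D := fun i => fderiv ℝ u x (EuclideanSpace.single i 1) with hD
  set H := fun i j =>
    fderiv ℝ (fderiv ℝ u) x (EuclideanSpace.single i 1) (EuclideanSpace.single j 1) with hH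
  have h1 := hsub (D 2) (D 0)
  have h2 := hsub (D 1) (D 0)
  have h3 := hsub (H 2 1 - t * H 0 1) (H 2 0 - t * H 0 0)
  have h4 := hsub (H 2 1) (H 0 1)
  have h5 := hsub (H 2 0) (H 0 0)
  simp only [hD, hH] at h1 h2 h3 h4 h5
  have hnn : ∀ i j, 0 ≤ |H i j| := fun i j => abs_nonneg _
  have hn1 : ∀ i, 0 ≤ |D i| := fun i => abs_nonneg _
  simp only [hD, hH] at hnn hn1
  linarith [abs_nonneg (u x), hn1 0, hn1 1, hn1 2, hnn 0 0, hnn 0 1, hnn 0 2, hnn 1 0, hnn 1 1,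
    hnn 1 2, hnn 2 0, hnn 2 1, hnn 2 2]

theorem fan_eq (t s r : ℝ) :
    (!₂[t * (1 - s - r), s, r] : EuclideanSpace ℝ (Fin 3)) =
      t • EuclideanSpace.single 0 1 +
        s • (EuclideanSpace.single 1 1 - t • EuclideanSpace.single 0 1) +
        r • (EuclideanSpace.single 2 1 - t • EuclideanSpace.single 0 1) := by
  ext i
  fin_cases i <;> simp
  ring

/-- Trace inequality at the corner `p` of the parallelogram `p + [0, 1/4] v + [0, 1/4] w`. -/
theorem enorm_apply_le_lintegral_parallelogram {E : Type*} [NormedAddCommGroup E]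
    [NormedSpace ℝ E] {u : E → ℝ} {U : Set E} (hU : IsOpen U) (hu : ContDiffOn ℝ 2 u U)
    {p v w : E} (hmem : ∀ s ∈ Icc (0 : ℝ) (1 / 4), ∀ r ∈ Icc (0 : ℝ) (1 / 4),
      p + s • v + r • w ∈ U) :
    ‖u p‖ₑ ≤ 16 * ∫⁻ s in Icc (0 : ℝ) (1 / 4), ∫⁻ r in Icc (0 : ℝ) (1 / 4),
      (‖u (p + s • v + r • w)‖ₑ + ‖fderiv ℝ u (p + s • v + r • w) w‖ₑ +
        (‖fderiv ℝ u (p + s • v + r • w) v‖ₑ +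
          ‖fderiv ℝ (fderiv ℝ u) (p + s • v + r • w) w v‖ₑ)) := by
  have hPs : ∀ s r : ℝ, HasDerivAt (fun s : ℝ => p + s • v + r • w) v s := fun s r => by
    simpa using (((hasDerivAt_id' s).smul_const v).const_add p).add_const (r • w)
  have hPr : ∀ s r : ℝ, HasDerivAt (fun r : ℝ => p + s • v + r • w) w r := fun s r => by
    simpa using ((hasDerivAt_id' r).smul_const w).const_add (p + s • v)
  have hPsc : ∀ r : ℝ, Continuous fun s : ℝ => p + s • v + r • w := fun r => by fun_prop
  have hPrc : ∀ s : ℝ, Continuous fun r : ℝ => p + s • v + r • w := fun s => by fun_prop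
  have hdu : ContDiffOn ℝ 1 (fderiv ℝ u) U := hu.fderiv_of_isOpen hU (by norm_num)
  have hddu : ContDiffOn ℝ 0 (fderiv ℝ (fderiv ℝ u)) U := hdu.fderiv_of_isOpen hU (by norm_num)
  have hd1 : ∀ x ∈ U, HasFDerivAt u (fderiv ℝ u x) x := fun x hx =>
    ((hu.differentiableOn (by norm_num)).differentiableAt (hU.mem_nhds hx)).hasFDerivAt
  have hd2 : ∀ x ∈ U, HasFDerivAt (fderiv ℝ u) (fderiv ℝ (fderiv ℝ u) x) x := fun x hx =>
    ((hdu.differentiableOn (by norm_num)).differentiableAt (hU.mem_nhds hx)).hasFDerivAt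
  have h0 : (0 : ℝ) ∈ Icc (0 : ℝ) (1 / 4) := by norm_num
  have hu_s : ∀ s ∈ Icc (0 : ℝ) (1 / 4), HasDerivAt (fun s : ℝ => u (p + s • v + (0 : ℝ) • w))
      (fderiv ℝ u (p + s • v + (0 : ℝ) • w) v) s := fun s hs =>
    HasFDerivAt.comp_hasDerivAt (f := fun s : ℝ => p + s • v + (0 : ℝ) • w) s
      (hd1 _ (hmem s hs 0 h0)) (hPs s 0)
  have hu_r : ∀ s ∈ Icc (0 : ℝ) (1 / 4), ∀ r ∈ Icc (0 : ℝ) (1 / 4),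
      HasDerivAt (fun r : ℝ => u (p + s • v + r • w)) (fderiv ℝ u (p + s • v + r • w) w) r :=
    fun s hs r hr => HasFDerivAt.comp_hasDerivAt (f := fun r : ℝ => p + s • v + r • w) r
      (hd1 _ (hmem s hs r hr)) (hPr s r)
  have hdu_r : ∀ s ∈ Icc (0 : ℝ) (1 / 4), ∀ r ∈ Icc (0 : ℝ) (1 / 4),
      HasDerivAt (fun r : ℝ => fderiv ℝ u (p + s • v + r • w) v)
        (fderiv ℝ (fderiv ℝ u) (p + s • v + r • w) w v) r := fun s hs r hr => by
    have h := HasFDerivAt.comp_hasDerivAt (f := fun r : ℝ => p + s • v + r • w) r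
      (hd2 _ (hmem s hs r hr)) (hPr s r)
    simpa using h.clm_apply (hasDerivAt_const r v)
  have hcorner := enorm_corner_le_lintegral (f := fun s r => u (p + s • v + r • w))
    (fs := fun s r => fderiv ℝ u (p + s • v + r • w) v)
    (fr := fun s r => fderiv ℝ u (p + s • v + r • w) w)
    (fsr := fun s r => fderiv ℝ (fderiv ℝ u) (p + s • v + r • w) w v)
    hu_s hu_r hdu_r
    ((hdu.continuousOn.comp (hPsc 0).continuousOn fun s hs => hmem s hs 0 h0).clm_apply
      continuousOn_const)
    (fun s hs => (hdu.continuousOn.comp (hPrc s).continuousOn fun r hr =>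
      hmem s hs r hr).clm_apply continuousOn_const)
    (fun s hs => ((hddu.continuousOn.comp (hPrc s).continuousOn fun r hr =>
      hmem s hs r hr).clm_apply continuousOn_const).clm_apply continuousOn_const)
  simpa using hcorner

theorem enorm_apply_edge_le_lintegral {u : EuclideanSpace ℝ (Fin 3) → ℝ}
    {U : Set (EuclideanSpace ℝ (Fin 3))} (hU : IsOpen U) (hu : ContDiffOn ℝ 2 u U) {t : ℝ}
    (ht : t ∈ Icc (0 : ℝ) 1)
    (hmem : ∀ s ∈ Icc (0 : ℝ) (1 / 4), ∀ r ∈ Icc (0 : ℝ) (1 / 4), !₂[t * (1 - s - r), s, r] ∈ U) :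
    ‖u (t • EuclideanSpace.single 0 1)‖ₑ ≤
      32 * ∫⁻ s in Icc (0 : ℝ) (1 / 4), ∫⁻ r in Icc (0 : ℝ) (1 / 4),
        ENNReal.ofReal (derivativeSum u !₂[t * (1 - s - r), s, r]) := by
  simp only [fan_eq] at hmem ⊢
  refine (enorm_apply_le_lintegral_parallelogram hU hu hmem).trans ?_
  have h32 : (32 : ENNReal) = 16 * 2 := by norm_num
  rw [h32, mul_assoc]
  refine mul_le_mul' le_rfl ?_
  rw [← lintegral_const_mul' _ _ (by norm_num)]
  refine lintegral_mono fun s => ?_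
  rw [← lintegral_const_mul' _ _ (by norm_num)]
  refine lintegral_mono fun r => ?_
  have h := sum_fan_derivatives_le u (t • EuclideanSpace.single 0 1 +
    s • (EuclideanSpace.single 1 1 - t • EuclideanSpace.single 0 1) +
    r • (EuclideanSpace.single 2 1 - t • EuclideanSpace.single 0 1)) ht rfl rfl
  simp only [Real.enorm_eq_ofReal_abs]
  rw [← ENNReal.ofReal_add (by positivity) (by positivity),
    ← ENNReal.ofReal_add (by positivity) (by positivity),
    ← ENNReal.ofReal_add (by positivity) (by positivity)]
  refine (ENNReal.ofReal_le_ofReal h).trans_eq ?_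
  rw [ENNReal.ofReal_mul zero_le_two, ENNReal.ofReal_ofNat]

theorem mem_convexHull_reference_tetrahedron {x s r : ℝ} (hx : 0 ≤ x) (hs : 0 ≤ s) (hr : 0 ≤ r)
    (hsum : x + s + r ≤ 1) :
    (!₂[x, s, r] : EuclideanSpace ℝ (Fin 3)) ∈ convexHull ℝ
      {0, EuclideanSpace.single 0 (1 : ℝ), EuclideanSpace.single 1 1, EuclideanSpace.single 2 1} := by
  have h := (convex_convexHull ℝ ({0, EuclideanSpace.single 0 (1 : ℝ), EuclideanSpace.single 1 1,
    EuclideanSpace.single 2 1} : Set (EuclideanSpace ℝ (Fin 3)))).sum_mem (t := Finset.univ)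
    (w := ![1 - x - s - r, x, s, r])
    (z := ![0, EuclideanSpace.single 0 1, EuclideanSpace.single 1 1, EuclideanSpace.single 2 1])
    (fun i _ => by fin_cases i <;> simp <;> linarith)
    (by simp [Fin.sum_univ_four]; ring)
    (fun i _ => subset_convexHull ℝ _ (by fin_cases i <;> simp))
  convert h using 1
  ext i
  fin_cases i <;> simp [Fin.sum_univ_four]

theorem norm_setIntegral_edge_le (u : EuclideanSpace ℝ (Fin 3) → ℝ) :
    ‖∫ x in segment ℝ 0 (EuclideanSpace.single 0 1), |u x| ∂μH[1]‖ ≤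
      (∫⁻ t in Icc (0 : ℝ) 1, ‖u (t • EuclideanSpace.single 0 1)‖ₑ).toReal := by
  set φ : ℝ → EuclideanSpace ℝ (Fin 3) := fun t => t • EuclideanSpace.single 0 1 with hφ
  have hiso : Isometry φ := Isometry.of_dist_eq fun a b => by
    simp [hφ, dist_eq_norm, ← sub_smul, norm_smul]
  have hemb : MeasurableEmbedding φ := hiso.isClosedEmbedding.measurableEmbedding
  have hseg : segment ℝ 0 (EuclideanSpace.single 0 1) = φ '' Icc 0 1 := by
    rw [segment_eq_image]
    simp [hφ]
  have hmap : (μH[1] : Measure (EuclideanSpace ℝ (Fin 3))).restrict (φ '' Icc 0 1) =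
      Measure.map φ (volume.restrict (Icc 0 1)) := by
    have h := hiso.map_hausdorffMeasure (d := 1) (Or.inl zero_le_one)
    rw [hausdorffMeasure_real] at h
    have himg : MeasurableSet (φ '' Icc 0 1) := hemb.measurableSet_image.2 measurableSet_Icc
    have h2 := hemb.restrict_map volume (φ '' Icc 0 1)
    rw [preimage_image_eq _ hiso.injective, h, Measure.restrict_restrict himg,
      inter_eq_left.2 (image_subset_range _ _)] at h2
    exact h2
  rw [hseg, hmap]
  refine (norm_integral_le_lintegral_norm _).trans_eq ?_
  rw [hemb.lintegral_map]
  simp [hφ, Real.enorm_eq_ofReal_abs]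

/-- `W^{2,1}`-type trace inequality on an edge of the reference
tetrahedron `T = conv{0, e₁, e₂, e₃} ⊂ ℝ³`:
`∫_{[0,e₁]} |u| dH¹ ≤ C (∫_T |u| + Σ_{1 ≤ |α| ≤ 2} ∫_T |∂^α u|)`
with an absolute constant `C`. -/
theorem trace_on_edge_of_reference_tetrahedron :
    ∃ C : ℝ, 0 < C ∧
      ∀ u : EuclideanSpace ℝ (Fin 3) → ℝ,
      let e : Fin 3 → EuclideanSpace ℝ (Fin 3) := fun i => EuclideanSpace.single i 1
      let T : Set (EuclideanSpace ℝ (Fin 3)) := convexHull ℝ {0, e 0, e 1, e 2}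
      (∃ U : Set (EuclideanSpace ℝ (Fin 3)), IsOpen U ∧ closure T ⊆ U ∧
        ContDiffOn ℝ 2 u U) →
      (∫ x in segment ℝ 0 (e 0), |u x| ∂μH[1]) ≤
        C * ((∫ x in T, |u x|) +
          ((∑ i : Fin 3, ∫ x in T, |fderiv ℝ u x (e i)|) +
            ∑ i : Fin 3, ∑ j : Fin 3, ∫ x in T, |iteratedFDeriv ℝ 2 u x ![e i, e j]|)) := by
  refine ⟨64, by norm_num, ?_⟩
  rintro u e T ⟨U, hU, hTU, hu⟩
  have hTc : IsCompact T := (Set.toFinite _).isCompact_convexHull ℝ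
  have hTm : MeasurableSet T := hTc.isClosed.measurableSet
  rw [hTc.isClosed.closure_eq] at hTU
  have hdu : ContDiffOn ℝ 1 (fderiv ℝ u) U := hu.fderiv_of_isOpen hU (by norm_num)
  have hddu : ContDiffOn ℝ 0 (fderiv ℝ (fderiv ℝ u)) U := hdu.fderiv_of_isOpen hU (by norm_num)
  have hc0 : ContinuousOn (fun x => |u x|) T := (hu.continuousOn.mono hTU).abs
  have hc1 : ∀ i, ContinuousOn (fun x => |fderiv ℝ u x (e i)|) T := fun i =>
    ((hdu.continuousOn.mono hTU).clm_apply continuousOn_const).abs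
  have hc2 : ∀ i j, ContinuousOn (fun x => |iteratedFDeriv ℝ 2 u x ![e i, e j]|) T :=
    fun i j => by
      simp only [iteratedFDeriv_two_apply]
      exact (((hddu.continuousOn.mono hTU).clm_apply continuousOn_const).clm_apply
        continuousOn_const).abs
  have hi0 := hc0.integrableOn_compact (μ := volume) hTc
  have hi1 := fun i => (hc1 i).integrableOn_compact (μ := volume) hTc
  have hi2 := fun i j => (hc2 i j).integrableOn_compact (μ := volume) hTc
  have hcd : ContinuousOn (derivativeSum u) T :=
    hc0.add ((continuousOn_finsetSum _ fun i _ => hc1 i).add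
      (continuousOn_finsetSum _ fun i _ => continuousOn_finsetSum _ fun j _ => hc2 i j))
  have hid := hcd.integrableOn_compact (μ := volume) hTc
  have hsum : ∫ x in T, derivativeSum u x = (∫ x in T, |u x|) +
      ((∑ i : Fin 3, ∫ x in T, |fderiv ℝ u x (e i)|) +
        ∑ i : Fin 3, ∑ j : Fin 3, ∫ x in T, |iteratedFDeriv ℝ 2 u x ![e i, e j]|) := by
    have hs1 := integrable_finsetSum Finset.univ fun i _ => hi1 i
    have hs2' := fun i => integrable_finsetSum Finset.univ fun j _ => hi2 i j
    have hs2 := integrable_finsetSum Finset.univ fun i _ => hs2' i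
    refine (integral_add hi0 (hs1.add hs2)).trans ?_
    rw [integral_add' hs1 hs2,
      integral_finsetSum _ fun i _ => hi1 i, integral_finsetSum _ fun i _ => hs2' i]
    simp_rw [integral_finsetSum Finset.univ fun j _ => hi2 _ j]
  rw [← hsum]
  set G : EuclideanSpace ℝ (Fin 3) → ENNReal :=
    T.indicator fun x => ENNReal.ofReal (derivativeSum u x) with hG
  have hGm : Measurable G := by
    classical
    have hGc : ContinuousOn (fun x => ENNReal.ofReal (derivativeSum u x)) T :=
      ENNReal.continuous_ofReal.comp_continuousOn hcd
    rw [hG, ← piecewise_eq_indicator]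
    exact hGc.measurable_piecewise continuousOn_const hTm
  have hmem : ∀ t ∈ Icc (0 : ℝ) 1, ∀ s ∈ Icc (0 : ℝ) (1 / 4), ∀ r ∈ Icc (0 : ℝ) (1 / 4),
      (!₂[t * (1 - s - r), s, r] : EuclideanSpace ℝ (Fin 3)) ∈ T := fun t ht s hs r hr => by
    have h1 : 0 ≤ 1 - s - r := by linarith [hs.2, hr.2]
    have h2 := mul_le_of_le_one_left h1 ht.2
    exact mem_convexHull_reference_tetrahedron (mul_nonneg ht.1 h1) hs.1 hr.1 (by linarith)
  have hbound : ∫⁻ t in Icc (0 : ℝ) 1, ‖u (t • e 0)‖ₑ ≤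
      ENNReal.ofReal (64 * ∫ x in T, derivativeSum u x) := by
    calc ∫⁻ t in Icc (0 : ℝ) 1, ‖u (t • e 0)‖ₑ
        ≤ ∫⁻ t in Icc (0 : ℝ) 1, 32 * ∫⁻ s in Icc (0 : ℝ) (1 / 4),
            ∫⁻ r in Icc (0 : ℝ) (1 / 4), G !₂[t * (1 - s - r), s, r] := by
          refine setLIntegral_mono' measurableSet_Icc fun t ht => ?_
          refine (enorm_apply_edge_le_lintegral hU hu ht fun s hs r hr =>
            hTU (hmem t ht s hs r hr)).trans_eq ?_
          congr 1
          refine setLIntegral_congr_fun measurableSet_Icc fun s hs =>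
            setLIntegral_congr_fun measurableSet_Icc fun r hr => ?_
          exact (indicator_of_mem (hmem t ht s hs r hr)
            fun x => ENNReal.ofReal (derivativeSum u x)).symm
      _ ≤ 32 * (2 * ∫⁻ x, G x) := by
          rw [lintegral_const_mul' _ _ (by norm_num)]
          exact mul_le_mul' le_rfl (lintegral_fan_le hGm)
      _ = ENNReal.ofReal (64 * ∫ x in T, derivativeSum u x) := by
          rw [hG, lintegral_indicator hTm, ← ofReal_integral_eq_lintegral_ofReal hid
            (Filter.Eventually.of_forall fun x => derivativeSum_nonneg u x), ← mul_assoc,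
            ENNReal.ofReal_mul (by norm_num), ENNReal.ofReal_ofNat]
          norm_num
  calc _ ≤ _ := le_abs_self _
    _ ≤ _ := norm_setIntegral_edge_le u
    _ ≤ _ := ENNReal.toReal_le_of_le_ofReal
      (mul_nonneg (by norm_num) (integral_nonneg fun x => derivativeSum_nonneg u x)) hbound
end

section
/- Let n ≥ 1 and let p₀, p₁, …, pₙ ∈ ℝⁿ be affinely independent points. Let λ₀ be the barycentric coordinate function associated with p₀, i.e., the affine function λ₀ : ℝⁿ → ℝ with λ₀(p₀) = 1 and λ₀(pᵢ) = 0 for i = 1,…,n. Then the Euclidean norm of the (constant) gradient of λ₀ equals 1/d, where d is the Euclidean distance from p₀ to the affine hyperplane spanned by p₁, …, pₙ. -/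
open MeasureTheory Set

/-- The distance from a point to the zero set of a nonconstant affine function, in terms of the
operator norm of its linear part. -/
theorem AffineMap.opNorm_linear_mul_infDist_zeros {E : Type*} [NormedAddCommGroup E]
    [NormedSpace ℝ E] (f : E →ᵃ[ℝ] ℝ) (L : E →L[ℝ] ℝ) (hL : ∀ v, f.linear v = L v)
    (hL0 : L ≠ 0) (x : E) :
    ‖L‖ * Metric.infDist x {y | f y = 0} = |f x| := by
  have hsub (y v : E) : f (y - v) = f y - L v := by
    have h := f.linearMap_vsub y (y - v)
    simp only [vsub_eq_sub, sub_sub_cancel, hL] at h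
    linarith
  have hmem (v : E) (hv : L v ≠ 0) : x - (f x / L v) • v ∈ {y | f y = 0} := by
    simp [hsub, hv]
  obtain ⟨v₀, hv₀⟩ : ∃ v, L v ≠ 0 := by
    by_contra! h
    exact hL0 (ContinuousLinearMap.ext h)
  have hpos : 0 < ‖L‖ := norm_pos_iff.2 hL0
  apply le_antisymm
  · rcases (Metric.infDist_nonneg (x := x) (s := {y | f y = 0})).eq_or_lt with hd | hd
    · simp [← hd]
    rw [← le_div_iff₀ hd]
    refine L.opNorm_le_bound (by positivity) fun v => ?_
    by_cases hv : L v = 0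
    · rw [hv, norm_zero]
      positivity
    have h := Metric.infDist_le_dist_of_mem (x := x) (hmem v hv)
    rw [dist_eq_norm, sub_sub_cancel, norm_smul, norm_div, div_mul_eq_mul_div,
      le_div_iff₀ (norm_pos_iff.2 hv)] at h
    rw [div_mul_eq_mul_div, le_div_iff₀ hd, mul_comm]
    exact h
  · rw [← div_le_iff₀' hpos, Metric.le_infDist ⟨_, hmem v₀ hv₀⟩]
    intro y hy
    rw [div_le_iff₀' hpos, dist_eq_norm]
    have h := hsub x (x - y)
    rw [sub_sub_cancel, show f y = 0 from hy] at h
    rw [show f x = L (x - y) by linarith]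
    exact L.le_opNorm _

/-- The zero set of a barycentric coordinate is the affine span of the other points. -/
theorem affineSpan_image_ne_eq_zeros {k V P ι : Type*} [Field k] [AddCommGroup V] [Module k V]
    [AddTorsor V P] [Fintype ι] (p : ι → P) (hp : affineSpan k (Set.range p) = ⊤) (j : ι)
    (f : P →ᵃ[k] k) (hfj : f (p j) = 1) (hf : ∀ i, i ≠ j → f (p i) = 0) :
    (affineSpan k (p '' {i | i ≠ j}) : Set P) = {x | f x = 0} := by
  classical
  apply Set.Subset.antisymm
  · intro x hx
    refine affineSpan_induction (p := fun x => f x = 0) hx ?_ ?_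
    · rintro _ ⟨i, hi, rfl⟩
      exact hf i hi
    · intro c u v w hu hv hw
      simp [f.map_vadd, f.linearMap_vsub, hu, hv, hw]
  · intro x hx
    obtain ⟨w, hw, rfl⟩ := eq_affineCombination_of_mem_affineSpan_of_fintype
      (show x ∈ affineSpan k (Set.range p) from hp ▸ AffineSubspace.mem_top k V x)
    have hwj : w j = 0 := by
      rw [Set.mem_ofPred_eq, Finset.map_affineCombination _ _ _ hw,
        Finset.affineCombination_eq_linear_combination _ _ _ hw,
        Finset.sum_eq_single j (fun i _ hi => by simp [hf i hi]) (by simp)] at hx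
      simpa [hfj] using hx
    refine affineCombination_mem_affineSpan_image hw (fun i _ hi => ?_) p
    rwa [not_not.1 hi]

/-- For affinely independent points `p₀, …, pₙ ∈ ℝⁿ`, the Euclidean
norm of the (constant) gradient of the barycentric coordinate `λ₀` (the affine
function with `λ₀(p₀) = 1`, `λ₀(pᵢ) = 0` for `i ≠ 0`) equals `1/d`, where `d` is the
distance from `p₀` to the affine hyperplane spanned by `p₁, …, pₙ`. -/
theorem norm_gradient_barycentric_coordinate
    (n : ℕ) (hn : 1 ≤ n)
    (p : Fin (n + 1) → EuclideanSpace ℝ (Fin n))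
    (hp : AffineIndependent ℝ p)
    (lam₀ : EuclideanSpace ℝ (Fin n) →ᵃ[ℝ] ℝ)
    (hlam₀ : lam₀ (p 0) = 1)
    (hlam : ∀ i : Fin (n + 1), i ≠ 0 → lam₀ (p i) = 0) :
    ‖LinearMap.toContinuousLinearMap lam₀.linear‖ =
      1 / Metric.infDist (p 0)
        (affineSpan ℝ (p '' {i | i ≠ 0}) : Set (EuclideanSpace ℝ (Fin n))) := by
  have hspan : affineSpan ℝ (Set.range p) = ⊤ := by
    rw [hp.affineSpan_eq_top_iff_card_eq_finrank_add_one]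
    simp
  have hne : LinearMap.toContinuousLinearMap lam₀.linear ≠ 0 := by
    intro h
    have h₁ := lam₀.linearMap_vsub (p 0) (p ⟨1, by omega⟩)
    rw [hlam₀, hlam ⟨1, by omega⟩ (by simp [Fin.ext_iff])] at h₁
    have h₂ := DFunLike.congr_fun h (p 0 -ᵥ p ⟨1, by omega⟩)
    simp only [LinearMap.coe_toContinuousLinearMap', h₁] at h₂
    simp at h₂
  have h := lam₀.opNorm_linear_mul_infDist_zeros _ (fun _ => rfl) hne (p 0)
  rw [← affineSpan_image_ne_eq_zeros p hspan 0 lam₀ hlam₀ hlam, hlam₀, abs_one] at h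
  exact eq_one_div_of_mul_eq_one_left h
end

section
/- Let 0 < h₁ ≤ h₃ and let β, δ ≥ 0 with β + δ < 1. With R(x) = ‖x‖, r(x) = (x₁² + x₂²)^{1/2} and θ(x) = r(x)/R(x), the integral of R^{−2β} θ^{−2δ} over the open cylinder Z = {x ∈ ℝ³ : x₁² + x₂² < h₁², 0 < x₃ < h₃} satisfies ∫_Z R^{−2β} θ^{−2δ} dx ≤ (2^δ π / (1 − β − δ)) h₃^{1+2δ} h₁^{2−2(β+δ)}. -/
open MeasureTheory Set Real

/-- Integration of a radial function over the plane in polar coordinates. -/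
theorem lintegral_radial_plane {g : ℝ → ENNReal} (hg : Measurable g) :
    ∫⁻ p : ℝ × ℝ, g (√(p.1 ^ 2 + p.2 ^ 2)) =
      ENNReal.ofReal (2 * π) * ∫⁻ r in Ioi (0 : ℝ), ENNReal.ofReal r * g r := by
  rw [← lintegral_comp_polarCoord_symm]
  have hcongr : ∫⁻ p : ℝ × ℝ in polarCoord.target, ENNReal.ofReal p.1 •
        g (√((polarCoord.symm p).1 ^ 2 + (polarCoord.symm p).2 ^ 2)) =
      ∫⁻ p : ℝ × ℝ in Ioi (0 : ℝ) ×ˢ Ioo (-π) π, (ENNReal.ofReal p.1 * g p.1) * 1 := by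
    rw [polarCoord_target]
    refine setLIntegral_congr_fun (measurableSet_Ioi.prod measurableSet_Ioo) fun p hp => ?_
    have hp0 : (0 : ℝ) < p.1 := hp.1
    have hsq : (p.1 * cos p.2) ^ 2 + (p.1 * sin p.2) ^ 2 = p.1 ^ 2 := by
      linear_combination p.1 ^ 2 * sin_sq_add_cos_sq p.2
    simp only [polarCoord_symm_apply, hsq, sqrt_sq hp0.le, smul_eq_mul, mul_one]
  rw [hcongr, Measure.volume_eq_prod, ← Measure.prod_restrict,
    lintegral_prod_mul (f := fun r => ENNReal.ofReal r * g r) (g := fun _ => 1)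
      (by fun_prop) (by fun_prop), mul_comm]
  congr 1
  simp [two_mul]

theorem lintegral_Ioo_zero_rpow {a h : ℝ} (ha : -1 < a) (hh : 0 ≤ h) :
    ∫⁻ r in Ioo 0 h, ENNReal.ofReal (r ^ a) = ENNReal.ofReal (h ^ (a + 1) / (a + 1)) := by
  have hint : IntegrableOn (fun r : ℝ => r ^ a) (Ioo 0 h) :=
    (intervalIntegral.intervalIntegrable_rpow' ha).1.mono_set Ioo_subset_Ioc_self
  rw [← ofReal_integral_eq_lintegral_ofReal hint
      ((ae_restrict_mem measurableSet_Ioo).mono fun r hr => rpow_nonneg hr.1.le a),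
    ← integral_Ioc_eq_integral_Ioo, ← intervalIntegral.integral_of_le hh,
    integral_rpow (Or.inl ha), zero_rpow (by linarith), sub_zero]

/-- The integral of `r ^ (-2s)` over the open disc of radius `h`. -/
theorem lintegral_disc_rpow {s h : ℝ} (hs : s < 1) (hh : 0 < h) :
    ∫⁻ p in {p : ℝ × ℝ | p.1 ^ 2 + p.2 ^ 2 < h ^ 2},
        ENNReal.ofReal (√(p.1 ^ 2 + p.2 ^ 2)) ^ (-(2 * s)) =
      ENNReal.ofReal (π / (1 - s) * h ^ (2 - 2 * s)) := by
  have hmeas : MeasurableSet {p : ℝ × ℝ | p.1 ^ 2 + p.2 ^ 2 < h ^ 2} :=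
    measurableSet_lt (by fun_prop) (by fun_prop)
  have hind : ∀ p : ℝ × ℝ, {p : ℝ × ℝ | p.1 ^ 2 + p.2 ^ 2 < h ^ 2}.indicator
        (fun p => ENNReal.ofReal (√(p.1 ^ 2 + p.2 ^ 2)) ^ (-(2 * s))) p =
      (Iio h).indicator (fun r => ENNReal.ofReal r ^ (-(2 * s))) (√(p.1 ^ 2 + p.2 ^ 2)) := by
    intro p
    simp only [indicator_apply, mem_ofPred_eq, mem_Iio, sqrt_lt' hh]
  rw [← lintegral_indicator hmeas, lintegral_congr hind,
    lintegral_radial_plane (Measurable.indicator (by fun_prop) measurableSet_Iio)]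
  have hradial : ∫⁻ r in Ioi (0 : ℝ), ENNReal.ofReal r *
        (Iio h).indicator (fun r => ENNReal.ofReal r ^ (-(2 * s))) r =
      ∫⁻ r in Ioo 0 h, ENNReal.ofReal (r ^ (1 - 2 * s)) := by
    simp_rw [← indicator_mul_right]
    rw [setLIntegral_indicator measurableSet_Iio, inter_comm, Ioi_inter_Iio]
    refine setLIntegral_congr_fun measurableSet_Ioo fun r hr => ?_
    simp only [ENNReal.ofReal_rpow_of_pos hr.1, ← ENNReal.ofReal_mul hr.1.le]
    rw [sub_eq_add_neg, rpow_add hr.1, rpow_one]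
  rw [hradial, lintegral_Ioo_zero_rpow (by linarith) hh.le, ← ENNReal.ofReal_mul (by positivity)]
  have hs' : 1 - s ≠ 0 := by linarith
  have he : 1 - 2 * s + 1 = 2 * (1 - s) := by ring
  rw [he, show 2 - 2 * s = 2 * (1 - s) by ring]
  congr 1
  field_simp

/-- Fubini's theorem on a cylinder for a function of the first two coordinates only. -/
theorem lintegral_cylinder_fst {D : Set (ℝ × ℝ)} (I : Set ℝ) {g : ℝ × ℝ → ENNReal}
    (hg : Measurable g) :
    ∫⁻ x in {x : EuclideanSpace ℝ (Fin 3) | (x 0, x 1) ∈ D ∧ x 2 ∈ I}, g (x 0, x 1) =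
      volume I * ∫⁻ p in D, g p := by
  have h₁ := EuclideanSpace.volume_preserving_symm_measurableEquiv_toLp (Fin 3)
  have h₂ := volume_preserving_piFinSuccAbove (fun _ : Fin 3 => ℝ) 2
  have h₃ : MeasurePreserving
      (Prod.map id (MeasurableEquiv.finTwoArrow : (Fin 2 → ℝ) ≃ᵐ ℝ × ℝ))
      (volume : Measure (ℝ × (Fin 2 → ℝ))) (volume : Measure (ℝ × ℝ × ℝ)) :=
    (MeasurePreserving.id volume).prod (volume_preserving_finTwoArrow ℝ)
  let e := ((MeasurableEquiv.toLp 2 (Fin 3 → ℝ)).symm.trans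
    (MeasurableEquiv.piFinSuccAbove (fun _ : Fin 3 => ℝ) 2)).trans
    ((MeasurableEquiv.refl ℝ).prodCongr MeasurableEquiv.finTwoArrow)
  have he : MeasurePreserving e := h₃.comp (h₂.comp h₁)
  have hcoord : ∀ x, e x = (x 2, x 0, x 1) := fun x => rfl
  have hprod := he.setLIntegral_comp_preimage_emb e.measurableEmbedding
    (fun q => 1 * g q.2) (I ×ˢ D)
  have hset : e ⁻¹' (I ×ˢ D) = {x | (x 0, x 1) ∈ D ∧ x 2 ∈ I} := by
    ext x
    simp [hcoord, and_comm]
  rw [hset] at hprod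
  simp only [hcoord] at hprod
  rw [Measure.volume_eq_prod, ← Measure.prod_restrict,
    lintegral_prod_mul (f := fun _ => 1) (by fun_prop) (by fun_prop)] at hprod
  simpa using hprod

/-- Pointwise domination of the weight by a power of the distance to the axis, where `ρ` is the
distance to the axis, `R` the distance to the origin and `h` bounds the cylinder. -/
theorem ofReal_weight_le {ρ R h β δ : ℝ} (hρ : 0 ≤ ρ) (hρR : ρ ≤ R) (hh : 0 < h)
    (hR : R ^ 2 ≤ 2 * h ^ 2) (hβ : 0 ≤ β) (hδ : 0 ≤ δ) :
    ENNReal.ofReal (R ^ (-(2 * β)) * (ρ / R) ^ (-(2 * δ))) ≤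
      ENNReal.ofReal (2 ^ δ * h ^ (2 * δ)) * ENNReal.ofReal ρ ^ (-(2 * (β + δ))) := by
  rcases hρ.eq_or_lt with rfl | hρ
  · rcases (add_nonneg hβ hδ).eq_or_lt with h0 | h0
    · obtain rfl : β = 0 := by linarith
      obtain rfl : δ = 0 := by linarith
      simp
    · have hpos : 0 < 2 ^ δ * h ^ (2 * δ) := by positivity
      rw [ENNReal.ofReal_zero, ENNReal.zero_rpow_of_neg (by linarith),
        ENNReal.mul_top (by simpa using hpos)]
      exact le_top
  · have hR0 : 0 < R := hρ.trans_le hρR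
    rw [ENNReal.ofReal_rpow_of_pos hρ, ← ENNReal.ofReal_mul (by positivity)]
    refine ENNReal.ofReal_le_ofReal ?_
    have h₁ : R ^ (-(2 * β)) ≤ ρ ^ (-(2 * β)) :=
      rpow_le_rpow_of_nonpos hρ hρR (by linarith)
    have h₂ : R ^ (2 * δ) ≤ 2 ^ δ * h ^ (2 * δ) := by
      have hpow := rpow_le_rpow (by positivity) hR hδ
      rwa [mul_rpow (by norm_num) (by positivity), ← rpow_natCast, ← rpow_mul hR0.le,
        ← rpow_natCast, ← rpow_mul hh.le, Nat.cast_ofNat] at hpow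
    calc R ^ (-(2 * β)) * (ρ / R) ^ (-(2 * δ))
        = R ^ (-(2 * β)) * (R ^ (2 * δ) * ρ ^ (-(2 * δ))) := by
          rw [div_rpow hρ.le hR0.le, rpow_neg hR0.le (2 * δ), div_inv_eq_mul, mul_comm (ρ ^ _)]
      _ ≤ ρ ^ (-(2 * β)) * ((2 ^ δ * h ^ (2 * δ)) * ρ ^ (-(2 * δ))) := by gcongr
      _ = 2 ^ δ * h ^ (2 * δ) * ρ ^ (-(2 * (β + δ))) := by
          rw [show -(2 * (β + δ)) = -(2 * β) + -(2 * δ) by ring, rpow_add hρ]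
          ring

/-- Weighted estimate on the cylinder
`Z = {x ∈ ℝ³ : x₁² + x₂² < h₁², 0 < x₃ < h₃}` (with `0 < h₁ ≤ h₃`): for `β, δ ≥ 0`
with `β + δ < 1`, writing `R = ‖x‖`, `r = (x₁²+x₂²)^{1/2}`, `θ = r/R`,
`∫_Z R^{−2β} θ^{−2δ} dx ≤ (2^δ π/(1 − β − δ)) h₃^{1+2δ} h₁^{2−2(β+δ)}`. -/
theorem weighted_integral_cylinder_bound
    (h₁ h₃ : ℝ) (hh₁ : 0 < h₁) (h₁₃ : h₁ ≤ h₃)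
    (β δ : ℝ) (hβ : 0 ≤ β) (hδ : 0 ≤ δ) (hβδ : β + δ < 1) :
    (∫⁻ x in {x : EuclideanSpace ℝ (Fin 3) |
        (x 0) ^ 2 + (x 1) ^ 2 < h₁ ^ 2 ∧ x 2 ∈ Ioo 0 h₃},
      ENNReal.ofReal (‖x‖ ^ (-(2 * β)) *
        (Real.sqrt ((x 0) ^ 2 + (x 1) ^ 2) / ‖x‖) ^ (-(2 * δ)))) ≤
      ENNReal.ofReal ((2 ^ δ * π / (1 - β - δ)) *
        h₃ ^ (1 + 2 * δ) * h₁ ^ (2 - 2 * (β + δ))) := by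
  have hh₃ : 0 < h₃ := hh₁.trans_le h₁₃
  let D : Set (ℝ × ℝ) := {p | p.1 ^ 2 + p.2 ^ 2 < h₁ ^ 2}
  let g : ℝ × ℝ → ENNReal := fun p =>
    ENNReal.ofReal (√(p.1 ^ 2 + p.2 ^ 2)) ^ (-(2 * (β + δ)))
  have hg : Measurable g := by fun_prop
  have hmeas : MeasurableSet {x : EuclideanSpace ℝ (Fin 3) |
      (x 0) ^ 2 + (x 1) ^ 2 < h₁ ^ 2 ∧ x 2 ∈ Ioo 0 h₃} := by
    have hdisc : MeasurableSet {x : EuclideanSpace ℝ (Fin 3) | x 0 ^ 2 + x 1 ^ 2 < h₁ ^ 2} :=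
      measurableSet_lt (by fun_prop) (by fun_prop)
    have hproj : Measurable fun x : EuclideanSpace ℝ (Fin 3) => x 2 := by fun_prop
    exact hdisc.inter (hproj measurableSet_Ioo)
  calc
    _ ≤ ∫⁻ x in {x : EuclideanSpace ℝ (Fin 3) | (x 0, x 1) ∈ D ∧ x 2 ∈ Ioo 0 h₃},
          ENNReal.ofReal (2 ^ δ * h₃ ^ (2 * δ)) * g (x 0, x 1) := by
      refine setLIntegral_mono' hmeas fun x hx => ?_
      obtain ⟨hxD, hx0, hx3⟩ := hx
      have hnorm : ‖x‖ ^ 2 = x 0 ^ 2 + x 1 ^ 2 + x 2 ^ 2 := by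
        rw [EuclideanSpace.real_norm_sq_eq, Fin.sum_univ_three]
      refine ofReal_weight_le (sqrt_nonneg _) (sqrt_le_iff.2 ⟨norm_nonneg x, ?_⟩) hh₃ ?_ hβ hδ
      · rw [hnorm]
        nlinarith [sq_nonneg (x 2)]
      · rw [hnorm]
        nlinarith
    _ = ENNReal.ofReal (2 ^ δ * h₃ ^ (2 * δ)) *
          (ENNReal.ofReal h₃ * ENNReal.ofReal (π / (1 - (β + δ)) * h₁ ^ (2 - 2 * (β + δ)))) := by
      rw [lintegral_const_mul _ (by fun_prop), lintegral_cylinder_fst _ hg,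
        lintegral_disc_rpow hβδ hh₁, Real.volume_Ioo, sub_zero]
    _ = _ := by
      rw [← ENNReal.ofReal_mul hh₃.le, ← ENNReal.ofReal_mul (by positivity)]
      congr 1
      rw [rpow_add hh₃, rpow_one, ← sub_sub]
      ring
end
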